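/- Let n ≥ 2 be an even integer, k ≥ 2 an integer, and let X_{n,m} = {x ∈ ℝ^n : ‖x‖ ≤ r_0} − ⋃_{i=1}^m {x ∈ ℝ^n : ‖x − x_i‖ < r_i} be a sphere world, where r_0 > 0, ‖x_i‖ + r_i < r_0 for i = 1,…,m, and ‖x_i − x_j‖ > r_i + r_j for all i ≠ j. Then the topological complexity of the configuration space F(X_{n,m},k) equals 2k−2 if m = 0, equals 2k if m = 1, and equals 2k+1 if m ≥ 2. -/

import Mathlib

open scoped Topology

/-- Ordered configuration space of `k` points in `X`: tuples of pairwise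
distinct points, i.e. injective functions `Fin k → X`, topologized as a
subspace of the product `X^k`. -/
abbrev Conf (X : Type*) [TopologicalSpace X] (k : ℕ) : Type _ :=
  {f : Fin k → X // Function.Injective f}

/-- `X × X` admits a cover by `m` open sets over each of which the endpoints
fibration admits a continuous section (a continuous motion planning rule). -/
def TCCover (X : Type*) [TopologicalSpace X] (m : ℕ) : Prop :=
  ∃ U : Fin m → Set (X × X),
    (∀ i, IsOpen (U i)) ∧ (⋃ i, U i) = Set.univ ∧
    ∀ i, ∃ s : C(↥(U i), C(unitInterval, X)),
      ∀ p : ↥(U i), (s p) 0 = (p : X × X).1 ∧ (s p) 1 = (p : X × X).2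

/-- Farber's topological complexity of a space, valued in `ℕ∞` (it is `⊤ = ∞`
if no finite motion-planning cover exists). -/
noncomputable def TopologicalComplexity (X : Type*) [TopologicalSpace X] : ℕ∞ :=
  sInf {m : ℕ∞ | ∃ c : ℕ, (c : ℕ∞) = m ∧ TCCover X c}

/-- The polynomial `t ↦ det (1 + t A)` is determined by its values at small positive nodes. -/
lemma exists_det_interpolation (E : Type*) [NormedAddCommGroup E] [NormedSpace ℝ E]
    [FiniteDimensional ℝ E] {δ : ℝ} (hδ : 0 < δ) :
    ∃ (s : Finset ℝ) (w : ℝ → ℝ), (∀ t ∈ s, 0 < t ∧ t < δ) ∧ ∑ t ∈ s, w t = 1 ∧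
      ∀ A : E →L[ℝ] E, (1 + A).det = ∑ t ∈ s, w t * (1 + t • A).det := by
  classical
  set d := Module.finrank ℝ E
  let v : ℕ → ℝ := fun j => δ / (j + 2)
  have hv : Function.Injective v := by
    intro a b hab
    have ha : (0 : ℝ) < a + 2 := by positivity
    have hb : (0 : ℝ) < b + 2 := by positivity
    have h := (div_eq_div_iff ha.ne' hb.ne').1 hab
    have h' := mul_left_cancel₀ hδ.ne' h
    exact_mod_cast (by linarith : (a : ℝ) = b)
  let s : Finset ℝ := (Finset.range (d + 1)).image v
  have hs : s.card = d + 1 := by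
    rw [Finset.card_image_of_injective _ hv, Finset.card_range]
  have hinj : Set.InjOn (id : ℝ → ℝ) (s : Set ℝ) := Function.injective_id.injOn
  refine ⟨s, fun t => (Lagrange.basis s id t).eval 1, ?_, ?_, ?_⟩
  · intro t ht
    obtain ⟨j, -, rfl⟩ := Finset.mem_image.1 ht
    have hj : (0 : ℝ) < j + 2 := by positivity
    refine ⟨div_pos hδ hj, (div_lt_iff₀ hj).2 ?_⟩
    nlinarith [(Nat.cast_nonneg j : (0 : ℝ) ≤ j)]
  · rw [← Polynomial.eval_finsetSum, Lagrange.sum_basis hinj (by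
      rw [← Finset.card_pos, hs]; omega), Polynomial.eval_one]
  · intro A
    let b := Module.finBasis ℝ E
    let M := LinearMap.toMatrix b b (A : E →ₗ[ℝ] E)
    let q : Polynomial ℝ := ((Polynomial.X : Polynomial ℝ) • M.map Polynomial.C +
      (1 : Matrix _ _ ℝ).map Polynomial.C).det
    have hq : ∀ t : ℝ, q.eval t = (1 + t • A).det := by
      intro t
      have h1 : q.eval t = (t • M + 1).det := by
        rw [← Polynomial.coe_evalRingHom, RingHom.map_det]
        congr 1
        ext i j
        by_cases hij : i = j <;> simp [hij, mul_comm t]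
      rw [h1, ContinuousLinearMap.det, ← LinearMap.det_toMatrix b]
      congr 1
      simp [M, add_comm, LinearMap.toMatrix_one]
    have hdeg : q.degree < s.card := by
      refine lt_of_le_of_lt Polynomial.degree_le_natDegree ?_
      rw [hs]
      have := Polynomial.natDegree_det_X_add_C_le M 1
      rw [Fintype.card_fin] at this
      exact_mod_cast Nat.lt_succ_of_le this
    have h := congrArg (Polynomial.eval 1) (Lagrange.eq_interpolate hinj hdeg)
    rw [hq, one_smul, Lagrange.interpolate_apply, Polynomial.eval_finsetSum] at h
    rw [h]
    refine Finset.sum_congr rfl fun t _ => ?_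
    rw [Polynomial.eval_mul, Polynomial.eval_C, id, hq, mul_comm]

/-- There is no `C¹` retraction of a Euclidean space onto its unit sphere. -/
theorem no_contDiff_retraction {E : Type*} [NormedAddCommGroup E] [InnerProductSpace ℝ E]
    [FiniteDimensional ℝ E] (u : E → E) (hu : ContDiff ℝ 1 u)
    (hid : ∀ x, ‖x‖ = 1 → u x = x) (hnorm : ∀ x, ‖u x‖ = 1) : False := by
  let mE : MeasurableSpace E := borel E
  have bE : BorelSpace E := ⟨rfl⟩
  let μ : MeasureTheory.Measure E := MeasureTheory.Measure.addHaar
  set K : Set E := Metric.closedBall 0 1 with hK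
  have hKc : IsCompact K := isCompact_closedBall 0 1
  have hconv : Convex ℝ K := convex_closedBall 0 1
  set g : E → E := fun x => u x - x with hg
  have hgc : ContDiff ℝ 1 g := hu.sub contDiff_id
  obtain ⟨L, hL⟩ := hgc.contDiffOn.exists_lipschitzOnWith one_ne_zero hconv hKc
  -- radial retraction onto the ball
  let π : E → E := fun x => (max 1 ‖x‖)⁻¹ • x
  have hpos : ∀ x : E, 0 < max 1 ‖x‖ := fun x => lt_max_of_lt_left one_pos
  have hπK : ∀ x, π x ∈ K := by
    intro x
    rw [hK, mem_closedBall_zero_iff, norm_smul, norm_inv, Real.norm_of_nonneg (hpos x).le,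
      inv_mul_le_iff₀ (hpos x), mul_one]
    exact le_max_right _ _
  have hπid : ∀ x ∈ K, π x = x := by
    intro x hx
    rw [hK, mem_closedBall_zero_iff] at hx
    simp [π, max_eq_left hx]
  have hgπ : ∀ x ∉ K, g (π x) = 0 := by
    intro x hx
    rw [hK, mem_closedBall_zero_iff, not_le] at hx
    have : ‖π x‖ = 1 := by
      simp only [π, max_eq_right hx.le, norm_smul, norm_inv, norm_norm]
      exact inv_mul_cancel₀ (by linarith)
    simp [hg, hid _ this]
  have hπL : ∀ x y, ‖π x - π y‖ ≤ 2 * ‖x - y‖ := by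
    intro x y
    have hx := hpos x
    have hy := hpos y
    have e : π x - π y = (max 1 ‖x‖)⁻¹ • (x - y) +
        ((max 1 ‖x‖)⁻¹ * (max 1 ‖y‖ - max 1 ‖x‖)) • π y := by
      simp only [π, smul_smul, smul_sub]
      rw [mul_sub, inv_mul_cancel₀ hx.ne', sub_mul, one_mul, sub_smul, mul_assoc,
        mul_inv_cancel₀ hy.ne', mul_one]
      abel
    have hi : (max 1 ‖x‖)⁻¹ ≤ 1 := inv_le_one_of_one_le₀ (le_max_left _ _)
    have hi0 : 0 ≤ (max 1 ‖x‖)⁻¹ := (inv_pos.2 hx).le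
    have hm : |max 1 ‖y‖ - max 1 ‖x‖| ≤ ‖x - y‖ := by
      refine (abs_max_sub_max_le_max 1 ‖y‖ 1 ‖x‖).trans ?_
      rw [sub_self, abs_zero, max_eq_right (abs_nonneg _), norm_sub_rev]
      exact abs_norm_sub_norm_le y x
    have hπy : ‖π y‖ ≤ 1 := mem_closedBall_zero_iff.1 (hπK y)
    rw [e]
    refine (norm_add_le _ _).trans ?_
    rw [norm_smul, norm_smul, norm_mul, Real.norm_of_nonneg hi0, Real.norm_eq_abs]
    have h1 : (max 1 ‖x‖)⁻¹ * ‖x - y‖ ≤ ‖x - y‖ := mul_le_of_le_one_left (norm_nonneg _) hi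
    have h2 : (max 1 ‖x‖)⁻¹ * |max 1 ‖y‖ - max 1 ‖x‖| ≤ ‖x - y‖ :=
      (mul_le_of_le_one_left (abs_nonneg _) hi).trans hm
    have h3 := mul_le_of_le_one_right (mul_nonneg hi0 (abs_nonneg (max 1 ‖y‖ - max 1 ‖x‖))) hπy
    linarith
  have hgL : ∀ x y, ‖g (π x) - g (π y)‖ ≤ 2 * L * ‖x - y‖ := by
    intro x y
    have h1 := hL.norm_sub_le (hπK x) (hπK y)
    have h2 := hπL x y
    have : (L : ℝ) * ‖π x - π y‖ ≤ L * (2 * ‖x - y‖) := mul_le_mul_of_nonneg_left h2 L.2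
    linarith
  -- the determinant is positive for small times
  have hdetc : Continuous fun z : ℝ × E => ((1 : E →L[ℝ] E) + z.1 • fderiv ℝ g z.2).det := by
    have := hgc.continuous_fderiv one_ne_zero
    exact ContinuousLinearMap.continuous_det.comp (by fun_prop)
  have hev : ∀ᶠ t : ℝ in 𝓝 0, ∀ x ∈ K, 0 < ((1 : E →L[ℝ] E) + t • fderiv ℝ g x).det := by
    refine hKc.eventually_forall_of_forall_eventually
      (P := fun t x => 0 < ((1 : E →L[ℝ] E) + t • fderiv ℝ g x).det) fun y _ => ?_
    refine (hdetc.tendsto (0, y)).eventually_const_lt ?_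
    simp [ContinuousLinearMap.det]
  obtain ⟨δ₁, hδ₁, hδ⟩ := Metric.eventually_nhds_iff.1 hev
  obtain ⟨δ, hδpos, hδ1, hδ2, hδ3⟩ : ∃ δ : ℝ, 0 < δ ∧ δ ≤ δ₁ ∧ δ ≤ 1 ∧ δ * (2 * L + 1) ≤ 1 := by
    have hL0 : (0 : ℝ) < 2 * L + 1 := by positivity
    refine ⟨min δ₁ (min 1 (1 / (2 * L + 1))), by positivity, min_le_left _ _,
      (min_le_right _ _).trans (min_le_left _ _), ?_⟩
    rw [← le_div_iff₀ hL0]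
    exact (min_le_right _ _).trans (min_le_right _ _)
  have hvol : ∀ t : ℝ, 0 < t → t < δ →
      ∫ x in K, ((1 : E →L[ℝ] E) + t • fderiv ℝ g x).det ∂μ = μ.real K := by
    intro t ht0 htδ
    let f : E → E := fun x => x + t • g x
    have htL : t * (2 * L) < 1 := by nlinarith [L.2]
    have hinj : Set.InjOn f K := by
      intro x hx y hy hxy
      have e : x - y = - (t • (g (π x) - g (π y))) := by
        rw [hπid x hx, hπid y hy, smul_sub]
        have : x + t • g x = y + t • g y := hxy
        rw [eq_neg_iff_add_eq_zero]
        rw [← sub_eq_zero] at this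
        rw [← this]; abel
      have h1 : ‖x - y‖ ≤ t * (2 * L * ‖x - y‖) := by
        conv_lhs => rw [e, norm_neg, norm_smul, Real.norm_of_nonneg ht0.le]
        exact mul_le_mul_of_nonneg_left (hgL x y) ht0.le
      have h2 : ‖x - y‖ = 0 := by
        by_contra hne
        have := (norm_nonneg (x - y)).lt_of_ne' hne
        nlinarith
      exact sub_eq_zero.1 (norm_eq_zero.1 h2)
    have himg : f '' K = K := by
      apply Set.Subset.antisymm
      · rintro _ ⟨x, hx, rfl⟩
        have : f x = (1 - t) • x + t • u x := by
          simp only [f, hg, smul_sub, sub_smul, one_smul]; abel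
        rw [this]
        exact hconv hx (by rw [hK, mem_closedBall_zero_iff, hnorm]) (by linarith) ht0.le (by ring)
      · intro y hy
        let T : E → E := fun x => y - t • g (π x)
        have hT : ContractingWith (t * (2 * L)).toNNReal T := by
          refine ⟨Real.toNNReal_lt_one.2 htL, LipschitzWith.of_dist_le_mul fun a b => ?_⟩
          rw [Real.coe_toNNReal _ (by positivity)]
          rw [dist_eq_norm, dist_eq_norm]
          have : T a - T b = -(t • (g (π a) - g (π b))) := by
            simp only [T, smul_sub]; abel
          rw [this, norm_neg, norm_smul, Real.norm_of_nonneg ht0.le]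
          have := mul_le_mul_of_nonneg_left (hgL a b) ht0.le
          linarith
        set x := hT.fixedPoint T with hx
        have hfix : y - t • g (π x) = x := hT.fixedPoint_isFixedPt
        have hxK : x ∈ K := by
          by_contra hxK
          rw [hgπ x hxK, smul_zero, sub_zero] at hfix
          exact hxK (hfix ▸ hy)
        refine ⟨x, hxK, ?_⟩
        rw [hπid x hxK] at hfix
        simp only [f]
        rw [← sub_eq_iff_eq_add.1 hfix]
    have hderiv : ∀ x ∈ K, HasFDerivWithinAt f ((1 : E →L[ℝ] E) + t • fderiv ℝ g x) K x := by
      intro x _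
      have h1 := ((hgc.differentiable one_ne_zero x).hasFDerivAt.const_smul t)
      exact ((hasFDerivAt_id x).add h1).hasFDerivWithinAt
    have hmeas : MeasurableSet K := Metric.isClosed_closedBall.measurableSet
    have key := MeasureTheory.integral_image_eq_integral_abs_det_fderiv_smul μ hmeas hderiv hinj
      (fun _ => (1 : ℝ))
    rw [himg] at key
    simp only [MeasureTheory.integral_const, smul_eq_mul, mul_one] at key
    rw [MeasureTheory.measureReal_restrict_apply_univ] at key
    rw [key]
    refine MeasureTheory.setIntegral_congr_fun hmeas fun x hx => ?_
    refine (abs_of_pos (hδ ?_ x hx)).symm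
    rw [Real.dist_eq, sub_zero, abs_of_pos ht0]
    linarith
  obtain ⟨s, w, hs, hw, hdet⟩ := exists_det_interpolation E hδpos
  have h1 : ∫ x in K, ((1 : E →L[ℝ] E) + fderiv ℝ g x).det ∂μ = μ.real K := by
    rw [funext fun x => hdet (fderiv ℝ g x)]
    rw [MeasureTheory.integral_finsetSum]
    · have : ∀ t ∈ s, ∫ x in K, w t * ((1 : E →L[ℝ] E) + t • fderiv ℝ g x).det ∂μ
          = w t * μ.real K := by
        intro t ht
        rw [MeasureTheory.integral_const_mul, hvol t (hs t ht).1 (hs t ht).2]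
      rw [Finset.sum_congr rfl this, ← Finset.sum_mul, hw, one_mul]
    · intro t _
      refine ContinuousOn.integrableOn_compact hKc ?_
      exact (continuous_const.mul (hdetc.comp (by fun_prop : Continuous fun x : E => (t, x)))).continuousOn
  have h0 : ∀ x, ((1 : E →L[ℝ] E) + fderiv ℝ g x).det = 0 := by
    intro x
    have hd : HasFDerivAt u ((1 : E →L[ℝ] E) + fderiv ℝ g x) x := by
      have h2 := (hasFDerivAt_id x).add (hgc.differentiable one_ne_zero x).hasFDerivAt
      have : (id + g : E → E) = u := funext fun y => add_sub_cancel y (u y)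
      rw [this] at h2
      exact h2
    have horth : ∀ v, inner ℝ (u x) (((1 : E →L[ℝ] E) + fderiv ℝ g x) v) = 0 := by
      intro v
      have h3 := hd.inner ℝ hd
      have hc : (fun y => inner ℝ (u y) (u y)) = fun _ => (1 : ℝ) := by
        ext y; rw [real_inner_self_eq_norm_sq, hnorm, one_pow]
      rw [hc] at h3
      have h4 := congrArg (fun A => A v) (h3.unique (hasFDerivAt_const (1 : ℝ) x))
      simp only [ContinuousLinearMap.comp_apply, ContinuousLinearMap.prod_apply,
        fderivInnerCLM_apply, zero_apply] at h4
      rw [real_inner_comm (u x)] at h4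
      linarith
    by_contra hne
    have hunit := (LinearMap.isUnit_iff_isUnit_det _).2 (isUnit_iff_ne_zero.2 hne)
    obtain ⟨v, hv⟩ := ((Module.End.isUnit_iff _).1 hunit).2 (u x)
    have h5 := horth v
    have hv' : ((1 : E →L[ℝ] E) + fderiv ℝ g x) v = u x := hv
    rw [hv', real_inner_self_eq_norm_sq, hnorm] at h5
    norm_num at h5
  simp only [h0, MeasureTheory.integral_zero] at h1
  have hμ : 0 < μ.real K := by
    refine ENNReal.toReal_pos ?_ hKc.measure_lt_top.ne
    exact (Metric.measure_closedBall_pos μ _ one_pos).ne'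
  exact hμ.ne h1

/-- A continuous self-map of a Euclidean space that is the identity far away hits the origin. -/
lemma exists_eq_zero_of_eq_id_outside {E : Type*} [NormedAddCommGroup E] [InnerProductSpace ℝ E]
    [FiniteDimensional ℝ E] (F : E → E) (hF : Continuous F) (R : ℝ)
    (hR : ∀ x, R ≤ ‖x‖ → F x = x) : ∃ x, F x = 0 := by
  by_contra! hne
  wlog hRpos : 0 < R generalizing R
  · exact this 1 (fun x hx => hR x (by linarith)) one_pos
  obtain ⟨g, hg, hgF, hsupp⟩ := Continuous.exists_contDiff_approx (f := fun x => F x - x) 1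
    (hF.sub continuous_id)
    (ε := fun x => ‖F x‖) (by fun_prop) (fun x => norm_pos_iff.2 (hne x))
  let f : E → E := fun x => x + g x
  have hf : ContDiff ℝ 1 f := contDiff_id.add (by exact_mod_cast hg)
  have hf0 : ∀ x, f x ≠ 0 := by
    intro x hx
    have h1 := hgF x
    rw [dist_eq_norm] at h1
    have : g x - (F x - x) = - F x := by
      have : g x = -x := by
        rw [eq_neg_iff_add_eq_zero, add_comm]; exact hx
      rw [this]; abel
    have h2 : ‖g x - (F x - x)‖ = ‖F x‖ := by rw [this, norm_neg]
    exact absurd h2 h1.ne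
  have hfid : ∀ x, R ≤ ‖x‖ → f x = x := by
    intro x hx
    have : g x = 0 := by
      by_contra hgx
      exact hsupp hgx (by simp [hR x hx])
    simp [f, this]
  refine no_contDiff_retraction (fun x => ‖f (R • x)‖⁻¹ • f (R • x)) ?_ ?_ ?_
  · have h1 : ContDiff ℝ 1 fun x : E => f (R • x) := hf.comp (contDiff_const_smul R)
    exact ((h1.norm ℝ fun x => hf0 _).inv fun x => norm_ne_zero_iff.2 (hf0 _)).smul h1
  · intro x hx
    have h1 : ‖R • x‖ = R := by rw [norm_smul, hx, mul_one, Real.norm_of_nonneg hRpos.le]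
    simp only [hfid _ h1.ge]
    rw [h1, smul_smul, inv_mul_cancel₀ hRpos.ne', one_smul]
  · intro x
    rw [norm_smul, norm_inv, norm_norm, inv_mul_cancel₀ (norm_ne_zero_iff.2 (hf0 _))]

/-- A continuous self-map of a finite-dimensional space that is the identity outside a ball is
surjective. -/
theorem surjective_of_eq_id_outside {V : Type*} [NormedAddCommGroup V] [NormedSpace ℝ V]
    [FiniteDimensional ℝ V] (F : V → V) (hF : Continuous F) (R : ℝ)
    (hR : ∀ x, R ≤ ‖x‖ → F x = x) : Function.Surjective F := by
  intro p
  let e := toEuclidean (E := V)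
  obtain ⟨x, hx⟩ := exists_eq_zero_of_eq_id_outside (fun x => e (F (e.symm x + p) - p))
    (by fun_prop) ((‖(e : V →L[ℝ] EuclideanSpace ℝ (Fin (Module.finrank ℝ V)))‖ + 1) * (|R| + ‖p‖)) (fun x hx => by
      by_cases h : R ≤ ‖e.symm x + p‖
      · simp [hR _ h]
      · exfalso
        rw [not_le] at h
        have h1 : ‖e.symm x‖ < |R| + ‖p‖ := by
          have h2 : ‖e.symm x‖ ≤ ‖e.symm x + p‖ + ‖p‖ := by
            simpa using norm_sub_le (e.symm x + p) p
          linarith [le_abs_self R]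
        have h3 : ‖x‖ ≤ ‖(e : V →L[ℝ] EuclideanSpace ℝ (Fin (Module.finrank ℝ V)))‖ * ‖e.symm x‖ := by
          simpa using (e : V →L[ℝ] EuclideanSpace ℝ (Fin (Module.finrank ℝ V))).le_opNorm (e.symm x)
        have h4 := norm_nonneg (e : V →L[ℝ] EuclideanSpace ℝ (Fin (Module.finrank ℝ V)))
        nlinarith [norm_nonneg (e.symm x)])
  refine ⟨e.symm x + p, ?_⟩
  have := e.map_eq_zero_iff.1 hx
  exact sub_eq_zero.1 this

/-- The nonzero vectors of a vector space. -/
abbrev Punctured (E : Type*) [Zero E] : Type _ := {v : E // v ≠ 0}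

section PunctureMaps

variable {E : Type*} [NormedAddCommGroup E] [InnerProductSpace ℝ E]

/-- Two maps to the punctured space are homotopic when the segments joining their values avoid
the origin. -/
lemma Punctured.homotopic_of_segment {X : Type*} [TopologicalSpace X] (f g : C(X, Punctured E))
    (h : ∀ x, ∀ t : ℝ, 0 ≤ t → t ≤ 1 → (f x : E) + t • ((g x : E) - f x) ≠ 0) :
    f.Homotopic g :=
  ⟨{ toFun := fun z => ⟨(f z.2 : E) + (z.1 : ℝ) • ((g z.2 : E) - f z.2),
        h z.2 z.1 z.1.2.1 z.1.2.2⟩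
     continuous_toFun := by fun_prop
     map_zero_left := fun x => by ext; simp
     map_one_left := fun x => by ext; simp }⟩

/-- The `i`-th coordinate of a product of unit spheres, as a nonzero vector. -/
def sphereCoord (E : Type*) [NormedAddCommGroup E] [InnerProductSpace ℝ E] {ι : Type*} (i : ι) :
    C(ι → ↥(Metric.sphere (0 : E) 1), Punctured E) where
  toFun x := ⟨(x i : E), fun h => by
    have := norm_eq_of_mem_sphere (x i)
    rw [h, norm_zero] at this
    exact zero_ne_one this⟩
  continuous_toFun := by fun_prop

/-- A tuple of maps whose components are homotopic to the coordinates of a product of spheres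
takes every tuple of directions as a value. -/
theorem exists_forall_direction {ι : Type*} [Fintype ι] [FiniteDimensional ℝ E]
    (f : ι → C(ι → ↥(Metric.sphere (0 : E) 1), Punctured E))
    (hf : ∀ i, (sphereCoord E i).Homotopic (f i)) (p : ι → ↥(Metric.sphere (0 : E) 1)) :
    ∃ x, ∀ i, ∃ s : ℝ, 0 < s ∧ (f i x : E) = s • (p i : E) := by
  classical
  have H : ∀ i, (sphereCoord E i).Homotopy (f i) := fun i => (hf i).some
  let nz : ι → E → ↥(Metric.sphere (0 : E) 1) := fun j v =>
    if h : v = 0 then p j else ⟨‖v‖⁻¹ • v, by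
      rw [mem_sphere_zero_iff_norm, norm_smul, norm_inv, norm_norm,
        inv_mul_cancel₀ (norm_ne_zero_iff.2 h)]⟩
  have hnz : ∀ j v, v ≠ 0 → ContinuousAt (nz j) v := by
    intro j v hv
    rw [Topology.IsInducing.subtypeVal.continuousAt_iff]
    have h1 : ContinuousAt (fun v : E => ‖v‖⁻¹ • v) v :=
      (continuousAt_id.norm.inv₀ (norm_ne_zero_iff.2 hv)).smul continuousAt_id
    refine h1.congr ?_
    filter_upwards [isOpen_ne.mem_nhds hv] with w hw
    simp only [nz, Function.comp, dif_neg (show ¬ w = 0 from hw)]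
  have hnzs : ∀ j v, ‖v‖ • (nz j v : E) = v := by
    intro j v
    by_cases h : v = 0
    · simp [h]
    · simp only [nz, dif_neg h]
      rw [smul_smul, mul_inv_cancel₀ (norm_ne_zero_iff.2 h), one_smul]
  let η : (ι → E) → ℝ := fun y => 1 - 2 * ‖fun j => ‖y j‖ - 1‖
  have hη : Continuous η := by fun_prop
  let τ : (ι → E) → unitInterval := fun y => Set.projIcc 0 1 zero_le_one (η y)
  have hτ : Continuous τ := continuous_projIcc.comp hη
  let X : (ι → E) → ι → ↥(Metric.sphere (0 : E) 1) := fun y j => nz j (y j)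
  let w : ι → (ι → E) → Punctured E := fun i y => H i (τ y, X y)
  let G : (ι → E) → ι → E := fun y i => ‖y i‖ • (‖(w i y : E)‖⁻¹ • (w i y : E))
  have hτ0 : ∀ y, η y ≤ 0 → G y = y := by
    intro y hy
    have : τ y = 0 := Set.projIcc_of_le_left _ hy
    funext i
    have hw : (w i y : E) = nz i (y i) := by
      simp only [w, this, ContinuousMap.Homotopy.apply_zero]
      rfl
    simp only [G, hw]
    rw [norm_eq_of_mem_sphere, inv_one, one_smul, hnzs]
  have hzero : ∀ y j, y j = 0 → η y < 0 := by
    intro y j hy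
    have := norm_le_pi_norm (fun j => ‖y j‖ - 1) j
    simp only [hy, norm_zero, zero_sub, norm_neg, norm_one] at this
    simp only [η]
    linarith
  have hGc : Continuous G := by
    rw [continuous_iff_continuousAt]
    intro y
    by_cases h : ∃ j, y j = 0
    · obtain ⟨j, hj⟩ := h
      refine continuousAt_id.congr ?_
      filter_upwards [(isOpen_lt hη continuous_const).mem_nhds (hzero y j hj)] with z hz
      exact (hτ0 z (le_of_lt hz)).symm
    · push Not at h
      have hX : ContinuousAt X y := by
        rw [continuousAt_pi]
        intro j
        exact (hnz j (y j) (h j)).comp (f := fun z : ι → E => z j) (continuousAt_apply j y)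
      rw [continuousAt_pi]
      intro i
      have hw : ContinuousAt (fun z => (w i z : E)) y :=
        continuous_subtype_val.continuousAt.comp
          ((H i).continuous.continuousAt.comp (hτ.continuousAt.prodMk hX))
      exact (continuousAt_apply i y).norm.smul
        ((hw.norm.inv₀ (norm_ne_zero_iff.2 (w i y).2)).smul hw)
  have hsurj := surjective_of_eq_id_outside G hGc 2 (by
    intro y hy
    apply hτ0
    obtain ⟨j, hj⟩ : ∃ j, (2 : ℝ) ≤ ‖y j‖ := by
      by_contra! hlt
      exact absurd hy (not_le.2 ((pi_norm_lt_iff two_pos).2 hlt))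
    have := norm_le_pi_norm (fun j => ‖y j‖ - 1) j
    simp only [η]
    have h2 := (le_abs_self (‖y j‖ - 1)).trans this
    linarith)
  obtain ⟨y, hy⟩ := hsurj fun i => (p i : E)
  have hGn : ∀ i, ‖G y i‖ = ‖y i‖ := by
    intro i
    simp only [G]
    rw [norm_smul, norm_smul, norm_inv, norm_norm, norm_norm,
      inv_mul_cancel₀ (norm_ne_zero_iff.2 (w i y).2), mul_one]
  have hy1 : ∀ i, ‖y i‖ = 1 := by
    intro i
    rw [← hGn, hy, norm_eq_of_mem_sphere]
  have hτ1 : τ y = 1 := by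
    apply Set.projIcc_of_right_le
    have : (fun j => ‖y j‖ - 1) = 0 := by
      funext j; simp [hy1]
    simp [η, this]
  refine ⟨X y, fun i => ⟨‖(f i (X y) : E)‖, norm_pos_iff.2 (f i (X y)).2, ?_⟩⟩
  have h1 := congrFun hy i
  simp only [G, hy1, one_smul, w, hτ1, ContinuousMap.Homotopy.apply_one] at h1
  rw [← h1, smul_smul, mul_inv_cancel₀ (norm_ne_zero_iff.2 (f i (X y)).2), one_smul]

end PunctureMaps

/-- A homotopy over an open set can be carried out globally, at full speed on a prescribed closed
subset. -/
theorem exists_homotopic_eqOn {X T : Type*} [TopologicalSpace X] [NormalSpace X]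
    [TopologicalSpace T] {C U : Set X} (hC : IsClosed C) (hU : IsOpen U) (hCU : C ⊆ U)
    (f g : C(X, T)) (h : (f.restrict U).Homotopic (g.restrict U)) :
    ∃ f' : C(X, T), f.Homotopic f' ∧ ∀ x ∈ C, f' x = g x := by
  classical
  obtain ⟨V, hV, hCV, hVU⟩ := normal_exists_closure_subset hC hU hCU
  obtain ⟨l, hl0, hl1, hl⟩ := exists_continuous_zero_one_of_isClosed hV.isClosed_compl hC
    (Set.disjoint_left.2 fun x hx hxC => hx (hCV hxC))
  let L : X → unitInterval := fun x => ⟨l x, hl x⟩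
  have hL : Continuous L := by fun_prop
  obtain ⟨H⟩ := h
  let K : unitInterval × X → T := fun z =>
    if hz : z.2 ∈ U then H (z.1 * L z.2, ⟨z.2, hz⟩) else f z.2
  have hK0 : ∀ z, L z.2 = 0 → K z = f z.2 := by
    intro z hz
    by_cases hzU : z.2 ∈ U
    · simp only [K, dif_pos hzU, hz, mul_zero, ContinuousMap.Homotopy.apply_zero]
      rfl
    · simp only [K, dif_neg hzU]
  have hKc : Continuous K := by
    rw [continuous_iff_continuousAt]
    intro z
    by_cases hz : z.2 ∈ U
    · have hopen : IsOpen {z : unitInterval × X | z.2 ∈ U} := hU.preimage continuous_snd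
      have : ContinuousOn K {z : unitInterval × X | z.2 ∈ U} := by
        rw [continuousOn_iff_continuous_domRestrict]
        have h1 : Continuous fun z : {z : unitInterval × X | z.2 ∈ U} =>
            H ((z : unitInterval × X).1 * L (z : unitInterval × X).2, ⟨(z : unitInterval × X).2, z.2⟩) :=
          by fun_prop
        convert h1 using 1
        funext z
        simp only [Set.domRestrict_apply, K, dif_pos (show (z : unitInterval × X).2 ∈ U from z.2)]
      exact this.continuousAt (hopen.mem_nhds hz)
    · have h1 : ContinuousAt (fun z : unitInterval × X => f z.2) z := by fun_prop
      refine h1.congr ?_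
      have hopen : IsOpen {z : unitInterval × X | z.2 ∈ (closure V)ᶜ} :=
        isClosed_closure.isOpen_compl.preimage continuous_snd
      filter_upwards [hopen.mem_nhds fun hzV => hz (hVU hzV)] with y hy
      refine (hK0 y (Subtype.ext ?_)).symm
      exact hl0 fun hyV => hy (subset_closure hyV)
  refine ⟨⟨fun x => K (1, x), by fun_prop⟩, ⟨⟨⟨K, hKc⟩, ?_, ?_⟩⟩, ?_⟩
  · intro x
    by_cases hx : x ∈ U
    · simp only [K, dif_pos hx, zero_mul, ContinuousMap.Homotopy.apply_zero]
      rfl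
    · simp only [K, dif_neg hx]
  · intro x
    rfl
  · intro x hx
    have h1 : L x = 1 := Subtype.ext (hl1 hx)
    simp only [ContinuousMap.coe_mk, K, dif_pos (hCU hx), h1, mul_one,
      ContinuousMap.Homotopy.apply_one]
    rfl

/-- A product of spheres has no open cover such that over the `i`-th member the `i`-th coordinate
is null-homotopic or, for the indices not in `s`, homotopic to minus a fixed coordinate with index
in `s`. -/
theorem no_cover_sphere_product {E : Type*} [NormedAddCommGroup E] [InnerProductSpace ℝ E]
    [FiniteDimensional ℝ E] {ι : Type*} [Fintype ι] (s : Set ι) (i₀ : ι)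
    (hi₀ : i₀ ∈ s) (b : ι → Punctured E)
    (U : ι → Set (ι → ↥(Metric.sphere (0 : E) 1))) (hU : ∀ i, IsOpen (U i))
    (hcov : ⋃ i, U i = Set.univ)
    (hs : ∀ i ∈ s, ((sphereCoord E i).restrict (U i)).Homotopic
      ((ContinuousMap.const _ (b i)).restrict (U i)))
    (hs' : ∀ i ∉ s, ∀ neg : C(Punctured E, Punctured E), (∀ v, (neg v : E) = -v) →
      ((sphereCoord E i).restrict (U i)).Homotopic
      ((neg.comp (sphereCoord E i₀)).restrict (U i))) : False := by
  classical
  let neg : C(Punctured E, Punctured E) := ⟨fun v => ⟨-v, neg_ne_zero.2 v.2⟩, by fun_prop⟩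
  have hfd : ProperSpace E := FiniteDimensional.proper ℝ E
  obtain ⟨C, hCcov, hC, hCU⟩ := exists_iUnion_eq_closed_subset hU (fun x => Set.toFinite _) hcov
  obtain ⟨f₀, hf₀, hf₀C⟩ := exists_homotopic_eqOn (hC i₀) (hU i₀) (hCU i₀) _ _ (hs i₀ hi₀)
  have key : ∀ i, ∃ f : C(ι → ↥(Metric.sphere (0 : E) 1), Punctured E),
      (sphereCoord E i).Homotopic f ∧ (i = i₀ → f = f₀) ∧
      ∀ x ∈ C i, (i ∈ s → f x = b i) ∧ (i ∉ s → f x = neg (f₀ x)) := by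
    intro i
    by_cases hi : i ∈ s
    · by_cases h0 : i = i₀
      · subst h0
        exact ⟨f₀, hf₀, fun _ => rfl, fun x hx => ⟨fun _ => hf₀C x hx, fun h => absurd hi h⟩⟩
      · obtain ⟨f, hf, hfC⟩ := exists_homotopic_eqOn (hC i) (hU i) (hCU i) _ _ (hs i hi)
        exact ⟨f, hf, fun h => absurd h h0, fun x hx => ⟨fun _ => hfC x hx, fun h => absurd hi h⟩⟩
    · have h1 : ((neg.comp (sphereCoord E i₀)).restrict (U i)).Homotopic
          ((neg.comp f₀).restrict (U i)) :=
        ((ContinuousMap.Homotopic.refl neg).comp hf₀).comp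
          (ContinuousMap.Homotopic.refl (⟨Subtype.val, continuous_subtype_val⟩ : C(U i, _)))
      obtain ⟨f, hf, hfC⟩ := exists_homotopic_eqOn (hC i) (hU i) (hCU i) _ _
        ((hs' i hi neg fun v => rfl).trans h1)
      exact ⟨f, hf, fun h => absurd (h ▸ hi₀) hi,
        fun x hx => ⟨fun h => absurd h hi, fun _ => hfC x hx⟩⟩
  choose f hf hf0 hfC using key
  let nrm : Punctured E → ↥(Metric.sphere (0 : E) 1) := fun v => ⟨-(‖(v : E)‖⁻¹ • (v : E)), by
    rw [mem_sphere_zero_iff_norm, norm_neg, norm_smul, norm_inv, norm_norm,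
      inv_mul_cancel₀ (norm_ne_zero_iff.2 v.2)]⟩
  have hcontra : ∀ (v : Punctured E) (r : ℝ), 0 < r → (v : E) = r • (nrm v : E) → False := by
    intro v r hr hv
    have h2 : (1 + r * ‖(v : E)‖⁻¹) • (v : E) = 0 := by
      rw [add_smul, one_smul, mul_smul]
      nth_rewrite 1 [hv]
      simp [nrm]
    have h3 : 0 < 1 + r * ‖(v : E)‖⁻¹ := by positivity
    exact (smul_ne_zero h3.ne' v.2) h2
  obtain ⟨x, hx⟩ := exists_forall_direction f hf fun i => if i ∈ s then nrm (b i) else nrm (b i₀)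
  obtain ⟨i, hi⟩ := Set.mem_iUnion.1 (hCcov ▸ Set.mem_univ x)
  obtain ⟨r, hr, hrx⟩ := hx i
  by_cases his : i ∈ s
  · rw [if_pos his, (hfC i x hi).1 his] at hrx
    exact hcontra _ r hr hrx
  · rw [if_neg his, (hfC i x hi).2 his] at hrx
    obtain ⟨r', hr', hrx'⟩ := hx i₀
    rw [if_pos hi₀, hf0 i₀ rfl] at hrx'
    have h1 : -(f₀ x : E) = r • (nrm (b i₀) : E) := hrx
    rw [hrx', ← neg_smul] at h1
    have h2 : (r + r') • (nrm (b i₀) : E) = 0 := by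
      rw [add_smul, ← h1, ← add_smul]; simp
    rcases smul_eq_zero.1 h2 with h3 | h3
    · linarith
    · have := norm_eq_of_mem_sphere (nrm (b i₀))
      rw [h3, norm_zero] at this
      exact zero_ne_one this

section TopologicalComplexity

variable {X Y : Type*} [TopologicalSpace X] [TopologicalSpace Y]

/-- A motion planning rule over a set is a homotopy between the two projections. -/
lemma exists_section_iff (U : Set (X × X)) :
    (∃ s : C(↥U, C(unitInterval, X)), ∀ p : ↥U, (s p) 0 = (p : X × X).1 ∧
      (s p) 1 = (p : X × X).2) ↔
    ((ContinuousMap.fst : C(X × X, X)).restrict U).Homotopic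
      ((ContinuousMap.snd : C(X × X, X)).restrict U) := by
  constructor
  · rintro ⟨s, hs⟩
    exact ⟨⟨⟨fun z => s z.2 z.1, by fun_prop⟩, fun p => (hs p).1, fun p => (hs p).2⟩⟩
  · rintro ⟨H⟩
    refine ⟨ContinuousMap.curry (H.toContinuousMap.comp ContinuousMap.prodSwap), fun p => ⟨?_, ?_⟩⟩
    · exact H.apply_zero p
    · exact H.apply_one p

lemma tcCover_iff {m : ℕ} : TCCover X m ↔ ∃ U : Fin m → Set (X × X),
    (∀ i, IsOpen (U i)) ∧ (⋃ i, U i) = Set.univ ∧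
    ∀ i, ((ContinuousMap.fst : C(X × X, X)).restrict (U i)).Homotopic
      ((ContinuousMap.snd : C(X × X, X)).restrict (U i)) := by
  simp only [TCCover, exists_section_iff]

lemma TCCover.mono {m m' : ℕ} (h : TCCover X m) (hm : m ≤ m') : TCCover X m' := by
  obtain ⟨U, hU, hcov, hs⟩ := tcCover_iff.1 h
  let W : Fin m' → Set (X × X) := fun i => if hi : (i : ℕ) < m then U ⟨i, hi⟩ else ∅
  have hW : ∀ i, (∃ j, W i = U j) ∨ W i = ∅ := fun i => by
    by_cases hi : (i : ℕ) < m
    exacts [Or.inl ⟨_, dif_pos hi⟩, Or.inr (dif_neg hi)]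
  refine tcCover_iff.2 ⟨W, fun i => ?_, ?_, fun i => ?_⟩
  · rcases hW i with ⟨j, h⟩ | h <;> rw [h]
    exacts [hU j, isOpen_empty]
  · rw [Set.eq_univ_iff_forall] at hcov ⊢
    intro x
    obtain ⟨i, hi⟩ := Set.mem_iUnion.1 (hcov x)
    refine Set.mem_iUnion.2 ⟨Fin.castLE hm i, ?_⟩
    simpa [W] using hi
  · rcases hW i with ⟨j, h⟩ | h <;> rw [h]
    · exact hs j
    · have : ((ContinuousMap.fst : C(X × X, X)).restrict ∅) =
          ((ContinuousMap.snd : C(X × X, X)).restrict ∅) := by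
        ext ⟨x, hx⟩
        exact hx.elim
      rw [this]

/-- Motion planning covers are inherited by homotopy retracts. -/
lemma TCCover.of_homotopic_id {m : ℕ} (h : TCCover Y m) (f : C(X, Y)) (g : C(Y, X))
    (hgf : (g.comp f).Homotopic (ContinuousMap.id X)) : TCCover X m := by
  obtain ⟨U, hU, hcov, hs⟩ := tcCover_iff.1 h
  refine tcCover_iff.2 ⟨fun i => Prod.map f f ⁻¹' U i,
    fun i => (hU i).preimage (by fun_prop), ?_, fun i => ?_⟩
  · rw [← Set.preimage_iUnion, hcov, Set.preimage_univ]
  · let F : C(↥(Prod.map f f ⁻¹' U i), ↥(U i)) :=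
      ⟨fun p => ⟨Prod.map f f p, p.2⟩, by fun_prop⟩
    have h1 := ((ContinuousMap.Homotopic.refl g).comp (hs i)).comp (ContinuousMap.Homotopic.refl F)
    have h2 := hgf.symm.comp (ContinuousMap.Homotopic.refl
      ((ContinuousMap.fst : C(X × X, X)).restrict (Prod.map f f ⁻¹' U i)))
    have h3 := hgf.comp (ContinuousMap.Homotopic.refl
      ((ContinuousMap.snd : C(X × X, X)).restrict (Prod.map f f ⁻¹' U i)))
    exact (h2.trans h1).trans h3

lemma topologicalComplexity_eq {N : ℕ} (h : TCCover X N) (hN : ∀ c, TCCover X c → N ≤ c) :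
    TopologicalComplexity X = N := by
  refine le_antisymm (sInf_le ⟨N, rfl, h⟩) (le_sInf ?_)
  rintro _ ⟨c, rfl, hc⟩
  exact_mod_cast hN c hc

/-- A lower bound for the number of motion planning rules: two maps from a product of spheres
into the space that are told apart by sufficiently many maps to the punctured space. -/
theorem card_lt_of_tcCover {E : Type*} [NormedAddCommGroup E] [InnerProductSpace ℝ E]
    [FiniteDimensional ℝ E] {ι : Type*} [Fintype ι] (s : Set ι) (i₀ : ι) (hi₀ : i₀ ∈ s)
    (b : ι → Punctured E) {c : ℕ} (h : TCCover X c)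
    (f g : C(ι → ↥(Metric.sphere (0 : E) 1), X)) (A : ι → C(X, Punctured E))
    (hs : ∀ i ∈ s, ((A i).comp f).Homotopic (sphereCoord E i) ∧
        ((A i).comp g).Homotopic (ContinuousMap.const _ (b i)) ∨
      ((A i).comp g).Homotopic (sphereCoord E i) ∧
        ((A i).comp f).Homotopic (ContinuousMap.const _ (b i)))
    (hs' : ∀ i ∉ s, ∀ neg : C(Punctured E, Punctured E), (∀ v, (neg v : E) = -v) →
      ((A i).comp g).Homotopic (sphereCoord E i) ∧
        ((A i).comp f).Homotopic (neg.comp (sphereCoord E i₀))) :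
    Fintype.card ι < c := by
  by_contra! hlt
  obtain ⟨U, hU, hcov, hU'⟩ := tcCover_iff.1 (h.mono hlt)
  let e := Fintype.equivFin ι
  let V : ι → Set (ι → ↥(Metric.sphere (0 : E) 1)) := fun i => f.prodMk g ⁻¹' U (e i)
  have key : ∀ i, (((A i).comp f).restrict (V i)).Homotopic (((A i).comp g).restrict (V i)) := by
    intro i
    let F : C(↥(V i), ↥(U (e i))) := ⟨fun p => ⟨f.prodMk g p, p.2⟩, by fun_prop⟩
    exact ((ContinuousMap.Homotopic.refl (A i)).comp (hU' (e i))).comp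
      (ContinuousMap.Homotopic.refl F)
  have res : ∀ i {p q : C(ι → ↥(Metric.sphere (0 : E) 1), Punctured E)}, p.Homotopic q →
      (p.restrict (V i)).Homotopic (q.restrict (V i)) := fun i p q hpq =>
    hpq.comp (ContinuousMap.Homotopic.refl (⟨Subtype.val, continuous_subtype_val⟩ : C(V i, _)))
  refine no_cover_sphere_product s i₀ hi₀ b V (fun i => (hU _).preimage (by fun_prop)) ?_ ?_ ?_
  · simp only [V]
    rw [← Set.preimage_iUnion, e.surjective.iUnion_comp U, hcov, Set.preimage_univ]
  · intro i hi
    rcases hs i hi with ⟨h1, h2⟩ | ⟨h1, h2⟩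
    · exact ((res i h1).symm.trans (key i)).trans (res i h2)
    · exact ((res i h1).symm.trans (key i).symm).trans (res i h2)
  · intro i hi neg hneg
    obtain ⟨h1, h2⟩ := hs' i hi neg hneg
    exact ((res i h1).symm.trans (key i).symm).trans (res i h2)

end TopologicalComplexity

section LowerBounds

variable {E : Type*} [NormedAddCommGroup E] [InnerProductSpace ℝ E]

/-- Maps to the punctured space are homotopic when one is close to a positive multiple of the
other. -/
lemma Punctured.homotopic_of_norm_sub_lt {X : Type*} [TopologicalSpace X] (f g : C(X, Punctured E))
    (h : ∀ x, ∃ r : ℝ, 0 < r ∧ ‖(f x : E) - r • (g x : E)‖ < r * ‖(g x : E)‖) :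
    f.Homotopic g := by
  refine Punctured.homotopic_of_segment f g fun x t ht0 ht1 hz => ?_
  obtain ⟨r, hr, hlt⟩ := h x
  have h1 : (1 - t) • (f x : E) = -t • (g x : E) := by
    refine sub_eq_zero.1 (Eq.trans ?_ hz)
    module
  rcases ht1.eq_or_lt with rfl | ht
  · refine (g x).2 ?_
    have : -(g x : E) = 0 := by simpa using h1.symm
    simpa using this
  · have h2 : (1 - t) * ‖(f x : E) - r • (g x : E)‖ = (t + (1 - t) * r) * ‖(g x : E)‖ := by
      rw [← abs_of_pos (sub_pos.2 ht), ← Real.norm_eq_abs, ← norm_smul, smul_sub, h1,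
        Real.norm_eq_abs, abs_of_pos (sub_pos.2 ht)]
      have : -t • (g x : E) - (1 - t) • r • (g x : E) = (-(t + (1 - t) * r)) • (g x : E) := by
        module
      rw [this, norm_smul, norm_neg, Real.norm_eq_abs, abs_of_nonneg]
      have := sub_pos.2 ht
      positivity
    have h3 := mul_lt_mul_of_pos_left hlt (sub_pos.2 ht)
    have h4 := mul_nonneg ht0 (norm_nonneg (g x : E))
    nlinarith

lemma Punctured.homotopic_of_pos_smul {X : Type*} [TopologicalSpace X] (f g : C(X, Punctured E))
    (h : ∀ x, ∃ r : ℝ, 0 < r ∧ (f x : E) = r • (g x : E)) : f.Homotopic g :=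
  Punctured.homotopic_of_norm_sub_lt f g fun x => by
    obtain ⟨r, hr, hx⟩ := h x
    refine ⟨r, hr, ?_⟩
    rw [hx, sub_self, norm_zero]
    exact mul_pos hr (norm_pos_iff.2 (g x).2)

/-- Configurations on concentric spheres. -/
lemma exists_concentric {W : Set E} {k : ℕ} {ι : Type*} (e : Fin k → ι) (p : E) {α β : ℝ}
    (hα : 0 < α) (hαβ : α < β) (hW : ∀ x, α ≤ ‖x - p‖ → ‖x - p‖ ≤ β → x ∈ W) :
    ∃ (ρ : Fin k → ℝ) (f : C(ι → ↥(Metric.sphere (0 : E) 1), Conf ↥W k)),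
      (∀ j, 0 < ρ j ∧ ρ j ≤ β) ∧ ∀ θ j, (((f θ).1 j : ↥W) : E) = p + ρ j • (θ (e j) : E) := by
  let ρ : Fin k → ℝ := fun j => α + (β - α) / k * j
  have hρ : ∀ j, α ≤ ρ j ∧ ρ j ≤ β := by
    intro j
    have hj : (j : ℝ) ≤ k := by exact_mod_cast j.2.le
    have hk : (0 : ℝ) < k := by exact_mod_cast j.pos
    have h1 : 0 ≤ β - α := by linarith
    refine ⟨le_add_of_nonneg_right (by positivity), ?_⟩
    have h2 : (β - α) / k * j ≤ (β - α) / k * k := by gcongr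
    rw [div_mul_cancel₀ _ hk.ne'] at h2
    simp only [ρ]
    linarith
  have hn : ∀ (θ : ι → ↥(Metric.sphere (0 : E) 1)) (j : Fin k),
      ‖p + ρ j • (θ (e j) : E) - p‖ = ρ j := by
    intro θ j
    rw [add_sub_cancel_left, norm_smul, norm_eq_of_mem_sphere, mul_one, Real.norm_eq_abs,
      abs_of_pos (hα.trans_le (hρ j).1)]
  refine ⟨ρ, ⟨fun θ => ⟨fun j => ⟨p + ρ j • (θ (e j) : E), hW _ ((hn θ j).symm ▸ (hρ j).1)
    ((hn θ j).symm ▸ (hρ j).2)⟩, fun i j hij => ?_⟩, ?_⟩,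
    fun j => ⟨hα.trans_le (hρ j).1, (hρ j).2⟩, fun θ j => rfl⟩
  · have h1 := hn θ i
    rw [show p + ρ i • (θ (e i) : E) = p + ρ j • (θ (e j) : E) from congrArg Subtype.val hij,
      hn] at h1
    have hk : (0 : ℝ) < k := by exact_mod_cast j.pos
    have h2 : (0 : ℝ) < (β - α) / k := div_pos (sub_pos.2 hαβ) hk
    have h3 := mul_left_cancel₀ h2.ne' (add_left_cancel h1)
    exact Fin.ext (by exact_mod_cast h3.symm)
  · fun_prop

variable [FiniteDimensional ℝ E]

/-- The lower bound in the presence of two obstacles. -/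
theorem two_mul_lt_of_tcCover {W : Set E} {k : ℕ} (hk : 0 < k) (p : Bool → E) {α β : Bool → ℝ}
    (hα : ∀ i, 0 < α i) (hαβ : ∀ i, α i < β i)
    (hW : ∀ i, ∀ x, α i ≤ ‖x - p i‖ → ‖x - p i‖ ≤ β i → x ∈ W) (hp : ∀ i, p i ∉ W)
    (hβ : ∀ i, β i < ‖p i - p !i‖) {c : ℕ} (h : TCCover (Conf ↥W k) c) : 2 * k < c := by
  choose ρ f hρ hf using fun i => exists_concentric (W := W) (fun j : Fin k => (j, i)) (p i)
    (hα i) (hαβ i) (hW i)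
  have hp' : ∀ i, p (!i) - p i ≠ 0 := fun i h => by
    have := hβ i
    rw [norm_sub_rev, h, norm_zero] at this
    linarith [hα i, hαβ i]
  let A : Fin k × Bool → C(Conf ↥W k, Punctured E) := fun a =>
    ⟨fun x => ⟨((x.1 a.1 : ↥W) : E) - p a.2, fun h => hp a.2 (by
      rw [← sub_eq_zero.1 h]; exact (x.1 a.1).2)⟩, (((continuous_subtype_val.comp
      ((continuous_apply a.1).comp continuous_subtype_val)).sub continuous_const).subtype_mk _)⟩
  let b : Fin k × Bool → Punctured E := fun a => ⟨p (!a.2) - p a.2, hp' a.2⟩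
  have hsame : ∀ a : Fin k × Bool, ((A a).comp (f a.2)).Homotopic (sphereCoord E a) := by
    intro a
    refine Punctured.homotopic_of_pos_smul _ _ fun θ => ⟨ρ a.2 a.1, (hρ _ _).1, ?_⟩
    simp [A, hf, sphereCoord]
  have hother : ∀ a : Fin k × Bool,
      ((A a).comp (f !a.2)).Homotopic (ContinuousMap.const _ (b a)) := by
    intro a
    refine Punctured.homotopic_of_norm_sub_lt _ _ fun θ => ⟨1, one_pos, ?_⟩
    have h1 := hβ (!a.2)
    rw [Bool.not_not] at h1
    have h2 := hρ (!a.2) a.1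
    simp only [A, b, hf, ContinuousMap.comp_apply, ContinuousMap.coe_mk, ContinuousMap.const_apply,
      one_smul, one_mul]
    rw [add_sub_right_comm, add_sub_cancel_left, norm_smul, norm_eq_of_mem_sphere, mul_one,
      Real.norm_eq_abs, abs_of_pos h2.1]
    exact h2.2.trans_lt h1
  have := card_lt_of_tcCover (ι := Fin k × Bool) Set.univ (⟨0, hk⟩, true) trivial b h (f true)
    (f false) A ?_ ?_
  · simpa [mul_comm] using this
  · rintro ⟨j, i⟩ -
    cases i
    · exact Or.inr ⟨hsame (j, false), hother (j, false)⟩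
    · exact Or.inl ⟨hsame (j, true), hother (j, true)⟩
  · intro i hi
    exact absurd trivial hi

/-- The lower bound for points moving around a base point. -/
theorem two_mul_add_two_le_of_tcCover {Z : Type*} [TopologicalSpace Z] {l : ℕ}
    (P : Fin (l + 1) → C(Z, E)) (P₀ : C(Z, E)) (hP : ∀ z, Function.Injective fun i => P i z)
    (hP₀ : ∀ z i, P i z ≠ P₀ z) (p u : E) (hu : ‖u‖ = 1) {α β : ℝ} (hα : 0 < α) (hαβ : α < β)
    (hlift : ∀ F : C(Fin (l + 1) ⊕ Fin l → ↥(Metric.sphere (0 : E) 1), Fin (l + 1) → E),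
      (∀ θ, Function.Injective (F θ)) →
      (∀ θ j, α ≤ ‖F θ j - p‖ ∧ ‖F θ j - p‖ ≤ β) →
      ∃ f : C(Fin (l + 1) ⊕ Fin l → ↥(Metric.sphere (0 : E) 1), Z),
        ∀ θ, P₀ (f θ) = p ∧ ∀ j, P j (f θ) = F θ j)
    {c : ℕ} (h : TCCover Z c) : 2 * l + 2 ≤ c := by
  let ε : ℝ := (β - α) / 2 / (l + 1)
  let ρ : ℝ := (α + β) / 2
  have hε : 0 < ε := by have := sub_pos.2 hαβ; positivity
  have hσ : ∀ j : Fin (l + 1), 0 ≤ ε * j ∧ ε * j < ρ - α := by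
    intro j
    refine ⟨by positivity, ?_⟩
    have hj : (j : ℝ) < l + 1 := by exact_mod_cast j.2
    calc ε * j < ε * (l + 1) := by gcongr
      _ = ρ - α := by simp only [ε, ρ]; field_simp; ring
  have hinj : ∀ i j : Fin (l + 1), ε * i = ε * j → i = j := by
    intro i j hij
    exact Fin.ext (by exact_mod_cast mul_left_cancel₀ hε.ne' hij)
  have hρ : ρ - α = β - ρ := by simp only [ρ]; ring
  let e : Fin (l + 1) → Fin (l + 1) ⊕ Fin l := Fin.cons (Sum.inl 0) Sum.inr
  have hnorm : ∀ (θ : Fin (l + 1) ⊕ Fin l → ↥(Metric.sphere (0 : E) 1)) a (r : ℝ), 0 ≤ r →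
      ‖r • (θ a : E)‖ = r := by
    intro θ a r hr
    rw [norm_smul, norm_eq_of_mem_sphere, mul_one, Real.norm_eq_abs, abs_of_nonneg hr]
  obtain ⟨f, hf⟩ := hlift ⟨fun θ j => p + (ρ - ε * j) • (θ (Sum.inl j) : E), by fun_prop⟩ (by
    intro θ i j hij
    have h1 := congrArg (fun x => ‖x - p‖) hij
    simp only [ContinuousMap.coe_mk, add_sub_cancel_left] at h1
    rw [hnorm _ _ _ (by linarith [hσ i]), hnorm _ _ _ (by linarith [hσ j])] at h1
    exact hinj i j (by linarith)) (by
    intro θ j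
    simp only [ContinuousMap.coe_mk, add_sub_cancel_left]
    rw [hnorm _ _ _ (by linarith [hσ j])]
    constructor <;> linarith [hσ j])
  obtain ⟨g, hg⟩ := hlift ⟨fun θ j => p + ρ • u + (ε * j) • (θ (e j) : E), by fun_prop⟩ (by
    intro θ i j hij
    have h1 := congrArg (fun x => ‖x - (p + ρ • u)‖) hij
    simp only [ContinuousMap.coe_mk, add_sub_cancel_left] at h1
    rw [hnorm _ _ _ (hσ i).1, hnorm _ _ _ (hσ j).1] at h1
    exact hinj i j h1) (by
    intro θ j
    simp only [ContinuousMap.coe_mk, add_assoc, add_sub_cancel_left]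
    have h1 : ‖ρ • u‖ = ρ := by
      rw [norm_smul, hu, mul_one, Real.norm_eq_abs, abs_of_nonneg (by linarith [hσ j])]
    have h2 := hnorm θ (e j) _ (hσ j).1
    have h3 := norm_add_le (ρ • u) ((ε * (j : ℝ)) • (θ (e j) : E))
    have h4 := norm_sub_le_norm_add (ρ • u) ((ε * (j : ℝ)) • (θ (e j) : E))
    rw [h1, h2] at h3 h4
    constructor <;> linarith [hσ j])
  have hρ0 : 0 < ρ := by linarith [hσ 0]
  let A : Fin (l + 1) ⊕ Fin l → C(Z, Punctured E) := Sum.elim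
    (fun j => ⟨fun z => ⟨P j z - P₀ z, sub_ne_zero.2 (hP₀ z j)⟩, by fun_prop⟩)
    (fun j => ⟨fun z => ⟨P j.succ z - P 0 z, sub_ne_zero.2 ((hP z).ne (Fin.succ_ne_zero j))⟩,
      by fun_prop⟩)
  have hρu : ρ • u ≠ 0 := by
    rw [← norm_pos_iff, norm_smul, hu, mul_one]
    exact norm_pos_iff.2 hρ0.ne'
  have := card_lt_of_tcCover (ι := Fin (l + 1) ⊕ Fin l) (Set.range Sum.inl) (Sum.inl 0) ⟨0, rfl⟩
    (fun _ => ⟨ρ • u, hρu⟩) h f g A ?_ ?_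
  · simp only [Fintype.card_sum, Fintype.card_fin] at this
    omega
  · rintro _ ⟨j, rfl⟩
    refine Or.inl ⟨?_, ?_⟩
    · refine Punctured.homotopic_of_pos_smul _ _ fun θ => ⟨ρ - ε * j, by linarith [hσ j], ?_⟩
      simp [A, hf, sphereCoord]
    · refine Punctured.homotopic_of_norm_sub_lt _ _ fun θ => ⟨1, one_pos, ?_⟩
      simp only [A, hg, Sum.elim_inl, ContinuousMap.comp_apply, ContinuousMap.coe_mk,
        ContinuousMap.const_apply, one_smul, one_mul]
      rw [add_sub_right_comm, add_sub_cancel_left, add_sub_cancel_left, hnorm _ _ _ (hσ j).1,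
        norm_smul, hu, mul_one, Real.norm_eq_abs, abs_of_pos hρ0]
      linarith [hσ j]
  · rintro (j | j) hj neg hneg
    · exact absurd ⟨j, rfl⟩ hj
    · refine ⟨?_, ?_⟩
      · refine Punctured.homotopic_of_pos_smul _ _ fun θ =>
          ⟨ε * (j.succ : Fin (l + 1)), by simp only [Fin.val_succ]; positivity, ?_⟩
        simp [A, hg, sphereCoord, e]
      · refine Punctured.homotopic_of_norm_sub_lt _ _ fun θ => ⟨ρ, hρ0, ?_⟩
        have h1 := hσ j.succ
        have h2 : 0 < ε * (j.succ : Fin (l + 1)) := by simp only [Fin.val_succ]; positivity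
        simp only [A, hf, Sum.elim_inr, ContinuousMap.comp_apply, ContinuousMap.coe_mk, hneg,
          sphereCoord, norm_neg, norm_eq_of_mem_sphere, mul_one]
        have h3 : p + (ρ - ε * (j.succ : Fin (l + 1))) • (θ (Sum.inl j.succ) : E) -
            (p + (ρ - ε * ((0 : Fin (l + 1)) : ℕ)) • (θ (Sum.inl 0) : E)) -
            ρ • -(θ (Sum.inl 0) : E) =
            (ρ - ε * (j.succ : Fin (l + 1))) • (θ (Sum.inl j.succ) : E) := by
          simp only [Fin.val_zero, Nat.cast_zero]
          module
        rw [h3, hnorm _ _ _ (by linarith)]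
        linarith

end LowerBounds

section Strata

/-- Homotopies over closed subsets extend to neighbourhoods, for maps into an open subset of a
finite-dimensional space. -/
theorem exists_isOpen_homotopic {V : Type*} [NormedAddCommGroup V] [NormedSpace ℝ V]
    [FiniteDimensional ℝ V] {Y : Set V} (hY : IsOpen Y) {X : Type*} [MetricSpace X] {A : Set X}
    (hA : IsClosed A) (f g : C(X, ↥Y)) (h : (f.restrict A).Homotopic (g.restrict A)) :
    ∃ U : Set X, IsOpen U ∧ A ⊆ U ∧ (f.restrict U).Homotopic (g.restrict U) := by
  classical
  obtain ⟨H⟩ := h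
  let Φ : unitInterval × X → V := fun z =>
    if hz : z.2 ∈ A then H (z.1, ⟨z.2, hz⟩) else if z.1 = 0 then f z.2 else g z.2
  have hΦ0 : ∀ x, Φ (0, x) = f x := by
    intro x
    by_cases hx : x ∈ A
    · simp only [Φ, dif_pos hx, ContinuousMap.Homotopy.apply_zero]
      rfl
    · simp only [Φ, dif_neg hx, if_pos]
  have hΦ1 : ∀ x, Φ (1, x) = g x := by
    intro x
    by_cases hx : x ∈ A
    · simp only [Φ, dif_pos hx, ContinuousMap.Homotopy.apply_one]
      rfl
    · simp only [Φ, dif_neg hx, one_ne_zero, if_false]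
  let C0 : Set (unitInterval × X) := {z | z.1 = 0}
  let C1 : Set (unitInterval × X) := {z | z.1 = 1}
  let CA : Set (unitInterval × X) := {z | z.2 ∈ A}
  have hC0 : IsClosed C0 := isClosed_eq continuous_fst continuous_const
  have hC1 : IsClosed C1 := isClosed_eq continuous_fst continuous_const
  have hCA : IsClosed CA := hA.preimage continuous_snd
  have h0 : ContinuousOn Φ C0 := by
    refine ContinuousOn.congr (f := fun z => (f z.2 : V)) (by fun_prop) ?_
    rintro ⟨t, x⟩ (rfl : t = 0)
    exact hΦ0 x
  have h1 : ContinuousOn Φ C1 := by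
    refine ContinuousOn.congr (f := fun z => (g z.2 : V)) (by fun_prop) ?_
    rintro ⟨t, x⟩ (rfl : t = 1)
    exact hΦ1 x
  have h2 : ContinuousOn Φ CA := by
    rw [continuousOn_iff_continuous_domRestrict]
    have h3 : Continuous fun z : CA =>
        (H ((z : unitInterval × X).1, ⟨(z : unitInterval × X).2, z.2⟩) : V) := by fun_prop
    convert h3 using 1
    funext z
    simp only [Set.domRestrict_apply, Φ, dif_pos (show (z : unitInterval × X).2 ∈ A from z.2)]
  have h3 : ContinuousOn Φ (C0 ∪ C1 ∪ CA) :=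
    (h0.union_of_isClosed h1 hC0 hC1).union_of_isClosed h2 (hC0.union hC1) hCA
  obtain ⟨G, hG⟩ := ContinuousMap.exists_restrict_eq ((hC0.union hC1).union hCA)
    ⟨_, continuousOn_iff_continuous_domRestrict.1 h3⟩
  have hG' : ∀ z ∈ C0 ∪ C1 ∪ CA, G z = Φ z := fun z hz =>
    congrArg (fun F : C(_, V) => F ⟨z, hz⟩) hG
  let U : Set X := {x | ∀ t : unitInterval, G (t, x) ∈ Y}
  have hU : IsOpen U := by
    have h4 : U = (Prod.snd '' (G ⁻¹' Y)ᶜ)ᶜ := by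
      ext x
      simp [U]
    rw [h4]
    exact (isClosedMap_snd_of_compactSpace _ (hY.preimage G.continuous).isClosed_compl).isOpen_compl
  refine ⟨U, hU, fun x hx t => ?_, ⟨⟨⟨fun z => ⟨G (z.1, z.2), z.2.2 z.1⟩, by fun_prop⟩, fun x => ?_,
    fun x => ?_⟩⟩⟩
  · rw [hG' (t, x) (Or.inr hx)]
    simp only [Φ, dif_pos hx]
    exact Subtype.coe_prop _
  · exact Subtype.ext ((hG' (0, x) (Or.inl (Or.inl rfl))).trans (hΦ0 x))
  · exact Subtype.ext ((hG' (1, x) (Or.inl (Or.inr rfl))).trans (hΦ1 x))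

/-- Homotopies over the fibres of a locally constant labelling can be glued. -/
lemma homotopic_restrict_of_fibres {Z Y T : Type*} [TopologicalSpace Z] [TopologicalSpace Y]
    (f g : C(Z, Y)) (L : Z → T) (A : Set Z) (hL : ∀ x ∈ A, ∀ᶠ z in 𝓝[A] x, L z = L x)
    (h : ∀ t, (f.restrict (L ⁻¹' {t})).Homotopic (g.restrict (L ⁻¹' {t}))) :
    (f.restrict A).Homotopic (g.restrict A) := by
  have H := fun t => (h t).some
  refine ⟨⟨⟨fun z => H (L z.2) (z.1, ⟨z.2, rfl⟩), ?_⟩, fun x => ?_, fun x => ?_⟩⟩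
  · rw [continuous_iff_continuousAt]
    rintro ⟨t, x⟩
    let S : Set (unitInterval × A) := {z | L z.2 = L x}
    have hS : S ∈ 𝓝 (t, x) := by
      have h1 : ∀ᶠ z : A in 𝓝 x, L z = L x := by
        rw [nhds_subtype_eq_comap_nhdsWithin]
        exact (hL x x.2).comap _
      exact (continuous_snd.tendsto (t, x)).eventually h1
    refine ContinuousOn.continuousAt ?_ hS
    rw [continuousOn_iff_continuous_domRestrict]
    have h3 : Continuous fun z : S => H (L x) ((z : unitInterval × A).1,
        ⟨((z : unitInterval × A).2 : Z), z.2⟩) := by fun_prop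
    convert h3 using 1
    funext ⟨z, hz⟩
    have key : ∀ t' (ht : L z.2 = t'), H (L z.2) (z.1, ⟨z.2, rfl⟩) = H t' (z.1, ⟨z.2, ht⟩) := by
      rintro _ rfl
      rfl
    exact key _ hz
  · exact (H (L x)).apply_zero _
  · exact (H (L x)).apply_one _

/-- Motion planning covers from a stratification of the space of pairs. -/
theorem tcCover_of_strata {V : Type*} [NormedAddCommGroup V] [NormedSpace ℝ V]
    [FiniteDimensional ℝ V] {Y : Set V} (hY : IsOpen Y) {T : Type*} (L : ↥Y × ↥Y → T) (σ : T → ℕ)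
    (a N : ℕ) (hσ : ∀ z, a ≤ σ (L z) ∧ σ (L z) < a + N)
    (hL : ∀ z₀, ∀ᶠ z in 𝓝 z₀, L z = L z₀ ∨ σ (L z₀) < σ (L z))
    (h : ∀ t, ((ContinuousMap.fst : C(↥Y × ↥Y, ↥Y)).restrict (L ⁻¹' {t})).Homotopic
      ((ContinuousMap.snd : C(↥Y × ↥Y, ↥Y)).restrict (L ⁻¹' {t}))) : TCCover ↥Y N := by
  let O : ℕ → Set (↥Y × ↥Y) := fun s => {z | s ≤ σ (L z)}
  have hO : ∀ s, IsOpen (O s) := by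
    intro s
    rw [isOpen_iff_mem_nhds]
    intro z₀ hz₀
    filter_upwards [hL z₀] with z hz
    rcases hz with hz | hz
    · exact le_of_le_of_eq hz₀ (congrArg σ hz).symm
    · exact le_trans hz₀ hz.le
  have key : ∀ s : ℕ, ∃ U : Set (↥Y × ↥Y), IsOpen U ∧ (∀ z, σ (L z) = s → z ∈ U) ∧
      ((ContinuousMap.fst : C(↥Y × ↥Y, ↥Y)).restrict U).Homotopic
        ((ContinuousMap.snd : C(↥Y × ↥Y, ↥Y)).restrict U) := by
    intro s
    let A : Set (O s) := {z | σ (L z) = s}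
    have hA : IsClosed A := by
      have h1 : A = (Subtype.val ⁻¹' O (s + 1))ᶜ := by
        ext ⟨z, hz⟩
        have : s ≤ σ (L z) := hz
        simp only [A, O, Set.mem_ofPred_eq, Set.mem_compl_iff, Set.mem_preimage]
        omega
      rw [h1]
      exact ((hO _).preimage continuous_subtype_val).isClosed_compl
    let p : C(O s, ↥Y) := (ContinuousMap.fst : C(↥Y × ↥Y, ↥Y)).restrict (O s)
    let q : C(O s, ↥Y) := (ContinuousMap.snd : C(↥Y × ↥Y, ↥Y)).restrict (O s)
    have hpq : (p.restrict A).Homotopic (q.restrict A) := by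
      refine homotopic_restrict_of_fibres p q (fun z => L z) A ?_ fun t => ?_
      · intro x hx
        have h1 : ∀ᶠ z : O s in 𝓝 x, L z = L x ∨ σ (L x) < σ (L z) :=
          (continuous_subtype_val.tendsto x).eventually (hL x)
        filter_upwards [mem_nhdsWithin_of_mem_nhds h1, self_mem_nhdsWithin] with z hz hzA
        rcases hz with hz | hz
        · exact hz
        · have h2 : σ (L x) = s := hx
          have h3 : σ (L z) = s := hzA
          omega
      · exact (h t).comp (ContinuousMap.Homotopic.refl
          (⟨fun z => ⟨z.1.1, z.2⟩, by fun_prop⟩ :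
            C(↥((fun z : O s => L z) ⁻¹' {t}), ↥(L ⁻¹' {t}))))
    obtain ⟨U, hU, hAU, hUh⟩ := exists_isOpen_homotopic hY hA p q hpq
    refine ⟨Subtype.val '' U, (hO s).isOpenMap_subtype_val U hU, fun z hz =>
      ⟨⟨z, hz.ge⟩, hAU hz, rfl⟩, ?_⟩
    have hmem : ∀ z : ↥(Subtype.val '' U), ∃ hz : (z : ↥Y × ↥Y) ∈ O s, (⟨z, hz⟩ : O s) ∈ U := by
      rintro ⟨_, ⟨z, hz, rfl⟩⟩
      exact ⟨z.2, hz⟩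
    exact hUh.comp (ContinuousMap.Homotopic.refl
      (⟨fun z => ⟨⟨z, (hmem z).1⟩, (hmem z).2⟩, by fun_prop⟩ : C(↥(Subtype.val '' U), ↥U)))
  choose U hU hUσ hUh using key
  refine tcCover_iff.2 ⟨fun i => U (a + i), fun i => hU _, ?_, fun i => hUh _⟩
  rw [Set.eq_univ_iff_forall]
  intro z
  obtain ⟨h1, h2⟩ := hσ z
  exact Set.mem_iUnion.2 ⟨⟨σ (L z) - a, by omega⟩, hUσ _ z (by simp only; omega)⟩

end Strata

section Partitions

/-- Coarsening an equivalence relation strictly decreases the number of classes. -/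
lemma card_quotient_lt_of_lt {ι : Type*} [Finite ι] {r r' : Setoid ι} (h : r < r') :
    Nat.card (Quotient r') < Nat.card (Quotient r) := by
  have hs : Function.Surjective (Quotient.map' (s₁ := r) (s₂ := r') id fun _ _ hxy => h.le hxy) := by
    intro x
    induction x using Quotient.inductionOn with
    | h x => exact ⟨Quotient.mk _ x, rfl⟩
  refine lt_of_le_of_ne (Nat.card_le_card_of_surjective _ hs) fun hcard => h.not_ge ?_
  have hb := (Nat.bijective_iff_surjective_and_card _).2 ⟨hs, hcard.symm⟩
  intro x y hxy
  refine Quotient.exact (hb.1 (a₁ := Quotient.mk r x) (a₂ := Quotient.mk r y) ?_)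
  exact Quotient.sound hxy

/-- The partition of the index set into fibres can only become finer under small perturbations. -/
lemma eventually_ker_le {ι Z : Type*} [Finite ι] [TopologicalSpace Z] (c : Z → ι → ℝ)
    (hc : Continuous c) (z₀ : Z) : ∀ᶠ z in 𝓝 z₀, Setoid.ker (c z) ≤ Setoid.ker (c z₀) := by
  have h1 : ∀ i j, ∀ᶠ z in 𝓝 z₀, c z i = c z j → c z₀ i = c z₀ j := by
    intro i j
    by_cases h : c z₀ i = c z₀ j
    · exact Filter.Eventually.of_forall fun z _ => h
    · have hopen : IsOpen {z | c z i ≠ c z j} := isOpen_ne_fun (by fun_prop) (by fun_prop)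
      filter_upwards [hopen.mem_nhds h] with z hz hz'
      exact absurd hz' hz
  filter_upwards [Filter.eventually_all.2 fun i => Filter.eventually_all.2 (h1 i)] with z hz i j hij
  exact hz i j hij

lemma eventually_ker_eq_or_lt {ι Z : Type*} [Finite ι] [TopologicalSpace Z] (c : Z → ι → ℝ)
    (hc : Continuous c) (z₀ : Z) : ∀ᶠ z in 𝓝 z₀, Setoid.ker (c z) = Setoid.ker (c z₀) ∨
      Nat.card (Quotient (Setoid.ker (c z₀))) < Nat.card (Quotient (Setoid.ker (c z))) := by
  filter_upwards [eventually_ker_le c hc z₀] with z hz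
  exact hz.eq_or_lt.imp_right card_quotient_lt_of_lt

lemma card_quotient_ker {ι : Type*} (c : ι → ℝ) :
    Nat.card (Quotient (Setoid.ker c)) = (Set.range c).ncard :=
  Nat.card_congr (Setoid.quotientKerEquivRange c)

end Partitions

section Planners

variable {E : Type*} [NormedAddCommGroup E] [InnerProductSpace ℝ E]

/-- Configurations of `k` points in the complement of the points `q j`, as a subset of `E ^ k`. -/
def puncturedConf {E : Type*} {m : ℕ} (q : Fin m → E) (k : ℕ) : Set (Fin k → E) :=
  {x | Function.Injective x ∧ ∀ i j, x i ≠ q j}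

lemma isOpen_puncturedConf {E : Type*} [NormedAddCommGroup E] {m : ℕ} (q : Fin m → E) (k : ℕ) : IsOpen (puncturedConf q k) := by
  have h : puncturedConf q k = (⋂ i, ⋂ j, ⋂ _ : i ≠ j, {x : Fin k → E | x i ≠ x j}) ∩
      ⋂ i, ⋂ j, {x : Fin k → E | x i ≠ q j} := by
    ext x
    simp only [puncturedConf, Set.mem_ofPred_eq, Set.mem_inter_iff, Set.mem_iInter]
    refine and_congr_left fun _ => ⟨fun h i j hij => h.ne hij, fun h i j hij => ?_⟩
    by_contra hne
    exact h i j hne hij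
  rw [h]
  refine IsOpen.inter ?_ ?_
  · exact isOpen_iInter_of_finite fun i => isOpen_iInter_of_finite fun j =>
      isOpen_iInter_of_finite fun _ => isOpen_ne_fun (by fun_prop) (by fun_prop)
  · exact isOpen_iInter_of_finite fun i => isOpen_iInter_of_finite fun j =>
      isOpen_ne_fun (by fun_prop) (by fun_prop)

variable {m k : ℕ} {q : Fin m → E} {A : Type*} [TopologicalSpace A]

lemma puncturedConf.homotopic_of_segment (x y : C(A, ↥(puncturedConf q k)))
    (h : ∀ a, ∀ t : ℝ, 0 ≤ t → t ≤ 1 →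
      (x a : Fin k → E) + t • ((y a : Fin k → E) - x a) ∈ puncturedConf q k) : x.Homotopic y :=
  ⟨{ toFun := fun z => ⟨(x z.2 : Fin k → E) + (z.1 : ℝ) • ((y z.2 : Fin k → E) - x z.2),
        h z.2 z.1 z.1.2.1 z.1.2.2⟩
     continuous_toFun := by fun_prop
     map_zero_left := fun x => by ext; simp
     map_one_left := fun x => by ext; simp }⟩

lemma mem_puncturedConf_of_inner (x : Fin k → E) (u : E)
    (hx : Function.Injective fun i => inner ℝ (x i) u)
    (hq : ∀ i j, inner ℝ (x i) u ≠ inner ℝ (q j) u) : x ∈ puncturedConf q k :=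
  ⟨fun _ _ hij => hx (congrArg (fun w => inner ℝ w u) hij),
    fun i j hij => hq i j (congrArg (fun w => inner ℝ w u) hij)⟩

/-- The coordinates of the moving and the fixed points in the direction `e`. -/
def heights (q : Fin m → E) (x : Fin k → E) (e : E) : Fin k ⊕ Fin m → ℝ :=
  Sum.elim (fun i => inner ℝ (x i) e) (fun j => inner ℝ (q j) e)

/-- A continuous positive function below all the nonzero gaps of a family with locally constant
coincidences. -/
lemma exists_pos_lt_gaps {ι : Type*} [Fintype ι] (c : A → ι → ℝ) (hc : Continuous c) (r : Setoid ι)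
    (hr : ∀ a, Setoid.ker (c a) = r) (K : ℝ) (hK : 1 < K) :
    ∃ ε : C(A, ℝ), (∀ a, 0 < ε a) ∧ ∀ a i j, c a i ≠ c a j → K * ε a < |c a i - c a j| := by
  classical
  have hr' : ∀ a i j, c a i = c a j ↔ r i j := fun a i j => by rw [← hr a]; rfl
  let R : Finset (ι × ι) := Finset.univ.filter fun s => ¬ r s.1 s.2
  let P : C(A, ℝ) := ⟨fun a => ∏ s ∈ R, min 1 |c a s.1 - c a s.2|, by fun_prop⟩
  have hpos : ∀ a, ∀ s ∈ R, 0 < min 1 |c a s.1 - c a s.2| := by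
    intro a s hs
    refine lt_min one_pos (abs_pos.2 (sub_ne_zero.2 fun h => ?_))
    exact (Finset.mem_filter.1 hs).2 ((hr' a _ _).1 h)
  have hP : ∀ a, 0 < P a := fun a => Finset.prod_pos (hpos a)
  refine ⟨⟨fun a => P a / (2 * K), by fun_prop⟩, fun a => div_pos (hP a) (by linarith),
    fun a i j hij => ?_⟩
  have hmem : (i, j) ∈ R := Finset.mem_filter.2 ⟨Finset.mem_univ _, fun h => hij ((hr' a i j).2 h)⟩
  have h1 : P a ≤ |c a i - c a j| := by
    have h2 : P a = _ := (Finset.mul_prod_erase R (fun s => min 1 |c a s.1 - c a s.2|) hmem).symm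
    have h3 : ∏ s ∈ R.erase (i, j), min 1 |c a s.1 - c a s.2| ≤ 1 :=
      Finset.prod_le_one (fun s hs => (hpos a s (Finset.mem_of_mem_erase hs)).le)
        fun s hs => min_le_left _ _
    rw [h2]
    calc _ ≤ min 1 |c a i - c a j| * 1 := mul_le_mul_of_nonneg_left h3 (hpos a _ hmem).le
      _ ≤ _ := by rw [mul_one]; exact min_le_right _ _
  simp only [ContinuousMap.coe_mk]
  have h2 : K * (P a / (2 * K)) = P a / 2 := by field_simp
  rw [h2]
  linarith [hP a]

lemma homotopic_of_heights (x y : C(A, ↥(puncturedConf q k))) (e v : C(A, E))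
    (he : ∀ a, ‖e a‖ = 1) (hv : ∀ a, ‖v a‖ = 1) (hev : ∀ a, inner ℝ (v a) (e a) = 0) (N : ℝ)
    (hN : ∀ j, ‖q j‖ ≤ N)
    (hy : ∀ a i, (y a : Fin k → E) i = (N + ((i : ℕ) + 1 : ℝ)) • v a)
    (r : Setoid (Fin k ⊕ Fin m)) (hr : ∀ a, Setoid.ker (heights q (x a : Fin k → E) (e a)) = r) :
    x.Homotopic y := by
  have hxi : ∀ i, Continuous fun a => (x a : Fin k → E) i := fun i =>
    (continuous_apply i).comp (continuous_subtype_val.comp x.continuous)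
  have hcont : Continuous fun a => heights q (x a : Fin k → E) (e a) := by
    refine continuous_pi fun s => ?_
    rcases s with i | j
    · exact Continuous.inner (hxi i) e.continuous
    · exact Continuous.inner (by fun_prop) (by fun_prop)
  obtain ⟨ε, hε, hgap⟩ := exists_pos_lt_gaps (fun a => heights q (x a : Fin k → E) (e a)) hcont r hr
    (k + 1 + 1) (by have : (0 : ℝ) ≤ k := Nat.cast_nonneg k; linarith)
  have hee : ∀ a, inner ℝ (e a) (e a) = (1 : ℝ) := fun a => by
    rw [real_inner_self_eq_norm_sq, he, one_pow]
  have hvv : ∀ a, inner ℝ (v a) (v a) = (1 : ℝ) := fun a => by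
    rw [real_inner_self_eq_norm_sq, hv, one_pow]
  have hve : ∀ a, inner ℝ (e a) (v a) = (0 : ℝ) := fun a => by
    rw [real_inner_comm, hev]
  let p : Fin k → A → ℝ := fun i a => inner ℝ ((x a : Fin k → E) i) (e a)
  have hp : ∀ i, Continuous (p i) := fun i => Continuous.inner (hxi i) e.continuous
  have hgap1 : ∀ a i l, p i a ≠ p l a → (k + 1 + 1) * ε a < |p i a - p l a| :=
    fun a i l h => hgap a (Sum.inl i) (Sum.inl l) h
  have hgap2 : ∀ a i j, p i a ≠ inner ℝ (q j) (e a) →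
      (k + 1 + 1) * ε a < |p i a - inner ℝ (q j) (e a)| :=
    fun a i j h => hgap a (Sum.inl i) (Sum.inr j) h
  have hi : ∀ i : Fin k, ((i : ℕ) : ℝ) + 1 ≤ k := fun i => by exact_mod_cast i.2
  have hi0 : ∀ i : Fin k, (0 : ℝ) ≤ ((i : ℕ) : ℝ) := fun i => Nat.cast_nonneg _
  -- perturbed heights are distinct
  have hsep1 : ∀ a, ∀ s : ℝ, 0 < s → s ≤ ε a → ∀ i l : Fin k,
      p i a + s * (i + 1) = p l a + s * (l + 1) → i = l := by
    intro a s hs0 hs i l hil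
    by_cases h : p i a = p l a
    · rw [h] at hil
      have h1 := mul_left_cancel₀ hs0.ne' (add_left_cancel hil)
      exact Fin.ext (by exact_mod_cast add_right_cancel h1)
    · exfalso
      have h1 := hgap1 a i l h
      have h2 : p i a - p l a = s * (l - i) := by linarith
      rw [h2, abs_mul, abs_of_pos hs0] at h1
      have h3 : |((l : ℕ) : ℝ) - (i : ℕ)| ≤ k := by
        rw [abs_le]; constructor <;> linarith [hi i, hi l, hi0 i, hi0 l]
      have h4 : s * |((l : ℕ) : ℝ) - (i : ℕ)| ≤ ε a * k :=
        mul_le_mul hs h3 (abs_nonneg _) (hε a).le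
      nlinarith [hε a]
  have hsep2 : ∀ a, ∀ s : ℝ, 0 < s → s ≤ ε a → ∀ (i : Fin k) j,
      p i a + s * (i + 1) ≠ inner ℝ (q j) (e a) := by
    intro a s hs0 hs i j hij
    by_cases h : p i a = inner ℝ (q j) (e a)
    · rw [h] at hij
      have h1 : 0 < s * ((i : ℕ) + 1 : ℝ) := mul_pos hs0 (by linarith [hi0 i])
      linarith
    · have h1 := hgap2 a i j h
      rw [← hij, sub_add_cancel_left, abs_neg, abs_of_nonneg
        (mul_nonneg hs0.le (by linarith [hi0 i]))] at h1
      have h4 : s * ((i : ℕ) + 1 : ℝ) ≤ ε a * k :=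
        mul_le_mul hs (hi i) (by linarith [hi0 i]) (hε a).le
      nlinarith [hε a]
  have hin1 : ∀ a (s : ℝ) (i : Fin k), inner ℝ ((x a : Fin k → E) i + (s * (i + 1)) • e a) (e a) =
      p i a + s * (i + 1) := by
    intro a s i
    rw [inner_add_left, real_inner_smul_left, hee, mul_one]
  have hmem1 : ∀ a, ∀ s : ℝ, 0 ≤ s → s ≤ ε a →
      (fun i : Fin k => (x a : Fin k → E) i + (s * (i + 1)) • e a) ∈ puncturedConf q k := by
    intro a s hs0 hs
    rcases hs0.eq_or_lt with rfl | hs0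
    · simp
    · refine mem_puncturedConf_of_inner _ (e a) (fun i l hil => ?_) fun i j => ?_
      · simp only [hin1] at hil
        exact hsep1 a s hs0 hs i l hil
      · rw [hin1]
        exact hsep2 a s hs0 hs i j
  let x₁ : C(A, ↥(puncturedConf q k)) :=
    ⟨fun a => ⟨fun i : Fin k => (x a : Fin k → E) i + (ε a * (i + 1)) • e a,
      hmem1 a _ (hε a).le le_rfl⟩, (continuous_pi fun i => (hxi i).add (by fun_prop)).subtype_mk _⟩
  let p₁ : Fin k → A → ℝ := fun i a => p i a + ε a * (i + 1)
  have hin2 : ∀ a (i : Fin k) (s : ℝ), inner ℝ (p₁ i a • e a + s • v a) (e a) = p₁ i a := by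
    intro a i s
    rw [inner_add_left, real_inner_smul_left, real_inner_smul_left, hee, hev]
    ring
  have hin3 : ∀ a (s s' : ℝ), inner ℝ (s • e a + s' • v a) (v a) = s' := by
    intro a s s'
    rw [inner_add_left, real_inner_smul_left, real_inner_smul_left, hvv, hve]
    ring
  let x₂ : C(A, ↥(puncturedConf q k)) :=
    ⟨fun a => ⟨fun i : Fin k => p₁ i a • e a + (N + ((i : ℕ) + 1 : ℝ)) • v a, by
      refine mem_puncturedConf_of_inner _ (e a) (fun i l hil => ?_) fun i j => ?_
      · simp only [hin2] at hil
        exact hsep1 a _ (hε a) le_rfl i l hil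
      · rw [hin2]
        exact hsep2 a _ (hε a) le_rfl i j⟩, by fun_prop⟩
  have h01 : x.Homotopic x₁ := by
    refine puncturedConf.homotopic_of_segment _ _ fun a t ht0 ht1 => ?_
    convert hmem1 a (t * ε a) (mul_nonneg ht0 (hε a).le)
      (mul_le_of_le_one_left (hε a).le ht1) using 1
    funext i
    simp only [x₁, ContinuousMap.coe_mk, Pi.add_apply, Pi.smul_apply, Pi.sub_apply]
    module
  have h12 : x₁.Homotopic x₂ := by
    refine puncturedConf.homotopic_of_segment _ _ fun a t ht0 ht1 => ?_
    have h1 : ∀ i : Fin k, inner ℝ (((x₁ a : Fin k → E) +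
        t • ((x₂ a : Fin k → E) - x₁ a)) i) (e a) = p₁ i a := by
      intro i
      rw [Pi.add_apply, Pi.smul_apply, Pi.sub_apply, inner_add_left, real_inner_smul_left,
        inner_sub_left]
      simp only [x₁, x₂, ContinuousMap.coe_mk, hin1, hin2, p₁]
      ring
    refine mem_puncturedConf_of_inner _ (e a) (fun i l hil => ?_) fun i j => ?_
    · simp only [h1] at hil
      exact hsep1 a _ (hε a) le_rfl i l hil
    · rw [h1]
      exact hsep2 a _ (hε a) le_rfl i j
  have h23 : x₂.Homotopic y := by
    refine puncturedConf.homotopic_of_segment _ _ fun a t ht0 ht1 => ?_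
    have h1 : ∀ i : Fin k, inner ℝ (((x₂ a : Fin k → E) +
        t • ((y a : Fin k → E) - x₂ a)) i) (v a) = N + ((i : ℕ) + 1 : ℝ) := by
      intro i
      rw [Pi.add_apply, Pi.smul_apply, Pi.sub_apply, inner_add_left, real_inner_smul_left,
        inner_sub_left, hy, real_inner_smul_left, hvv]
      simp only [x₂, ContinuousMap.coe_mk, hin3]
      ring
    refine mem_puncturedConf_of_inner _ (v a) (fun i l hil => ?_) fun i j => ?_
    · simp only [h1] at hil
      exact Fin.ext (by exact_mod_cast add_right_cancel (add_left_cancel hil))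
    · rw [h1]
      have h2 := real_inner_le_norm (q j) (v a)
      rw [hv, mul_one] at h2
      linarith [hN j, hi0 i]
  exact (h01.trans h12).trans h23

end Planners

section PunctConfCovers

variable {E : Type*} [NormedAddCommGroup E] [InnerProductSpace ℝ E]

lemma ncard_range_heights {m k : ℕ} (q : Fin m → E) (x : Fin k → E) (e : E) :
    (Set.range fun j => inner ℝ (q j) e).ncard ≤ (Set.range (heights q x e)).ncard ∧
      (Set.range (heights q x e)).ncard ≤ (Set.range fun j => inner ℝ (q j) e).ncard + k := by
  rw [heights, Set.Sum.elim_range]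
  refine ⟨Set.ncard_le_ncard Set.subset_union_right (Set.toFinite _), ?_⟩
  refine (Set.ncard_union_le _ _).trans ?_
  rw [add_comm]
  gcongr
  rw [← Set.image_univ]
  refine (Set.ncard_image_le (Set.toFinite _)).trans ?_
  simp

lemma continuous_heights {A : Type*} [TopologicalSpace A] {m k : ℕ} (q : Fin m → E)
    (x : C(A, ↥(puncturedConf q k))) (e : C(A, E)) :
    Continuous fun a => heights q (x a : Fin k → E) (e a) := by
  refine continuous_pi fun s => ?_
  rcases s with i | j
  · exact Continuous.inner ((continuous_apply i).comp (continuous_subtype_val.comp x.continuous))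
      e.continuous
  · exact Continuous.inner continuous_const e.continuous

variable [FiniteDimensional ℝ E]

/-- The motion planner with `2 * k + 1` rules, for any number of obstacles. -/
theorem tcCover_puncturedConf {m k : ℕ} (q : Fin m → E) (e v : E) (he : ‖e‖ = 1) (hv : ‖v‖ = 1)
    (hev : inner ℝ v e = 0) : TCCover ↥(puncturedConf q k) (2 * k + 1) := by
  let c : ↥(puncturedConf q k) → Fin k ⊕ Fin m → ℝ := fun x => heights q x e
  have hc : Continuous c := continuous_heights q (ContinuousMap.id _) (ContinuousMap.const _ e)
  have hc₁ : Continuous fun z : ↥(puncturedConf q k) × ↥(puncturedConf q k) => c z.1 :=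
    hc.comp continuous_fst
  have hc₂ : Continuous fun z : ↥(puncturedConf q k) × ↥(puncturedConf q k) => c z.2 :=
    hc.comp continuous_snd
  let d := (Set.range fun j => inner ℝ (q j) e).ncard
  let N : ℝ := ∑ j, ‖q j‖
  have hN : ∀ j, ‖q j‖ ≤ N := fun j =>
    Finset.single_le_sum (f := fun j => ‖q j‖) (fun i _ => norm_nonneg _) (Finset.mem_univ j)
  have hvv : inner ℝ v v = (1 : ℝ) := by rw [real_inner_self_eq_norm_sq, hv, one_pow]
  let y₀ : ↥(puncturedConf q k) := ⟨fun i => (N + ((i : ℕ) + 1 : ℝ)) • v, by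
    refine mem_puncturedConf_of_inner _ v (fun i l hil => ?_) fun i j => ?_
    · simp only [real_inner_smul_left, hvv, mul_one] at hil
      exact Fin.ext (by exact_mod_cast add_right_cancel (add_left_cancel hil))
    · rw [real_inner_smul_left, hvv]
      have h2 := real_inner_le_norm (q j) v
      rw [hv, mul_one] at h2
      have h3 : (0 : ℝ) ≤ (i : ℕ) := Nat.cast_nonneg _
      linarith [hN j]⟩
  have key : ∀ {A : Type _} [TopologicalSpace A] (x : C(A, ↥(puncturedConf q k)))
      (r : Setoid (Fin k ⊕ Fin m)), (∀ a, Setoid.ker (c (x a)) = r) →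
      x.Homotopic (ContinuousMap.const A y₀) := fun x r hr =>
    homotopic_of_heights x _ (ContinuousMap.const _ e) (ContinuousMap.const _ v) (fun _ => he)
      (fun _ => hv) (fun _ => hev) N hN (fun _ _ => rfl) r hr
  refine tcCover_of_strata (isOpen_puncturedConf q k)
    (fun z => (Setoid.ker (c z.1), Setoid.ker (c z.2)))
    (fun t => Nat.card (Quotient t.1) + Nat.card (Quotient t.2)) (2 * d) _ (fun z => ?_)
    (fun z₀ => ?_) fun t => ?_
  · simp only [card_quotient_ker]
    have h1 := ncard_range_heights q z.1.1 e
    have h2 := ncard_range_heights q z.2.1 e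
    simp only [c, d]
    omega
  · filter_upwards [eventually_ker_eq_or_lt _ hc₁ z₀,
      eventually_ker_eq_or_lt _ hc₂ z₀] with z h1 h2
    rcases h1 with h1 | h1 <;> rcases h2 with h2 | h2
    · exact Or.inl (by rw [h1, h2])
    · exact Or.inr (by rw [h1]; omega)
    · exact Or.inr (by rw [h2]; omega)
    · exact Or.inr (by omega)
  · exact (key _ t.1 fun a => congrArg Prod.fst a.2).trans
      (key _ t.2 fun a => congrArg Prod.snd a.2).symm

/-- The motion planner with `2 * k` rules for one obstacle, using a continuous field of
directions orthogonal to the direction of the first moving point. -/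
theorem tcCover_puncturedConf_zero (l : ℕ) (J : E →L[ℝ] E) (hJ : ∀ x, ‖J x‖ = ‖x‖)
    (hJ' : ∀ x, inner ℝ (J x) x = 0) :
    TCCover ↥(puncturedConf (fun _ : Fin 1 => (0 : E)) (l + 1)) (2 * (l + 1)) := by
  classical
  let q : Fin 1 → E := fun _ => 0
  let e : C(↥(puncturedConf q (l + 1)), E) :=
    ⟨fun x => ‖(x : Fin (l + 1) → E) 0‖⁻¹ • (x : Fin (l + 1) → E) 0, by
      have h0 : Continuous fun x : ↥(puncturedConf q (l + 1)) => (x : Fin (l + 1) → E) 0 :=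
        (continuous_apply 0).comp continuous_subtype_val
      exact (h0.norm.inv₀ fun x => norm_ne_zero_iff.2 (x.2.2 0 0)).smul h0⟩
  have hx0 : ∀ x : ↥(puncturedConf q (l + 1)), 0 < ‖(x : Fin (l + 1) → E) 0‖ := fun x =>
    norm_pos_iff.2 (x.2.2 0 0)
  have he : ∀ x, ‖e x‖ = 1 := by
    intro x
    simp only [e, ContinuousMap.coe_mk, norm_smul, norm_inv, norm_norm]
    exact inv_mul_cancel₀ (hx0 x).ne'
  let c : ↥(puncturedConf q (l + 1)) → Fin (l + 1) ⊕ Fin 1 → ℝ := fun x => heights q x (e x)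
  have hc : Continuous c := continuous_heights q (ContinuousMap.id _) e
  have hc₁ : Continuous fun z : ↥(puncturedConf q (l + 1)) × ↥(puncturedConf q (l + 1)) => c z.1 :=
    hc.comp continuous_fst
  have hc₂ : Continuous fun z : ↥(puncturedConf q (l + 1)) × ↥(puncturedConf q (l + 1)) => c z.2 :=
    hc.comp continuous_snd
  have hcard : ∀ x, 2 ≤ (Set.range (c x)).ncard ∧ (Set.range (c x)).ncard ≤ l + 2 := by
    intro x
    constructor
    · have h1 : c x (Sum.inl 0) ≠ c x (Sum.inr 0) := by
        simp only [c, heights, Sum.elim_inl, Sum.elim_inr, q, inner_zero_left, e,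
          ContinuousMap.coe_mk, real_inner_smul_right, real_inner_self_eq_norm_sq]
        have := hx0 x
        positivity
      rw [← Set.ncard_pair h1]
      refine Set.ncard_le_ncard ?_ (Set.toFinite _)
      rintro _ (rfl | rfl)
      exacts [⟨_, rfl⟩, ⟨_, rfl⟩]
    · rw [← Set.image_univ]
      refine (Set.ncard_image_le (Set.toFinite _)).trans ?_
      simp
  let D : C(Punctured E, ↥(puncturedConf q (l + 1))) :=
    ⟨fun u => ⟨fun i => (0 + ((i : ℕ) + 1 : ℝ)) • (u : E), fun i j hij => by
      have h1 := smul_left_injective ℝ u.2 hij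
      exact Fin.ext (by exact_mod_cast add_right_cancel (add_left_cancel h1)), fun i j =>
      smul_ne_zero (by positivity) u.2⟩, by fun_prop⟩
  let v : C(↥(puncturedConf q (l + 1)), Punctured E) :=
    ⟨fun x => ⟨J (e x), fun h => by
      have := hJ (e x)
      rw [h, he, norm_zero] at this
      exact zero_ne_one this⟩, by fun_prop⟩
  have key : ∀ {A : Type _} [TopologicalSpace A] (x : C(A, ↥(puncturedConf q (l + 1))))
      (r : Setoid (Fin (l + 1) ⊕ Fin 1)), (∀ a, Setoid.ker (c (x a)) = r) →
      x.Homotopic (D.comp (v.comp x)) := fun x r hr =>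
    homotopic_of_heights x _ (e.comp x) (⟨fun a => v (x a), by fun_prop⟩) (fun _ => he _)
      (fun a => (hJ _).trans (he _)) (fun a => hJ' _) 0 (fun j => norm_zero.le) (fun _ _ => rfl)
      r hr
  let L : ↥(puncturedConf q (l + 1)) × ↥(puncturedConf q (l + 1)) →
      Setoid (Fin (l + 1) ⊕ Fin 1) × Setoid (Fin (l + 1) ⊕ Fin 1) × Prop := fun z =>
    (Setoid.ker (c z.1), Setoid.ker (c z.2), e z.2 ≠ -e z.1)
  refine tcCover_of_strata (isOpen_puncturedConf q (l + 1)) L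
    (fun t => Nat.card (Quotient t.1) + Nat.card (Quotient t.2.1) + if t.2.2 then 1 else 0)
    4 _ (fun z => ?_) (fun z₀ => ?_) fun t => ?_
  · simp only [L, card_quotient_ker]
    have h1 := hcard z.1
    have h2 := hcard z.2
    split_ifs <;> omega
  · have h3 : ∀ᶠ z in 𝓝 z₀, e z₀.2 ≠ -e z₀.1 → e z.2 ≠ -e z.1 := by
      by_cases h : e z₀.2 ≠ -e z₀.1
      · have hopen : IsOpen {z : ↥(puncturedConf q (l + 1)) × ↥(puncturedConf q (l + 1)) |
            e z.2 ≠ -e z.1} := isOpen_ne_fun (by fun_prop) (by fun_prop)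
        filter_upwards [hopen.mem_nhds h] with z hz _ using hz
      · exact Filter.Eventually.of_forall fun z hz => absurd hz h
    filter_upwards [eventually_ker_eq_or_lt _ hc₁ z₀,
      eventually_ker_eq_or_lt _ hc₂ z₀, h3] with z h1 h2 h3
    by_cases ha : e z₀.2 ≠ -e z₀.1
    · have hb := h3 ha
      rcases h1 with h1 | h1 <;> rcases h2 with h2 | h2
      · exact Or.inl (by simp only [L, h1, h2, eq_true ha, eq_true hb])
      all_goals refine Or.inr ?_
      all_goals simp only [L, if_pos ha, if_pos hb]
      · rw [h1]; omega
      · rw [h2]; omega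
      · omega
    · by_cases hb : e z.2 ≠ -e z.1
      · refine Or.inr ?_
        simp only [L, if_neg ha, if_pos hb]
        rcases h1 with h1 | h1 <;> rcases h2 with h2 | h2
        · rw [h1, h2]; omega
        · rw [h1]; omega
        · rw [h2]; omega
        · omega
      · rcases h1 with h1 | h1 <;> rcases h2 with h2 | h2
        · exact Or.inl (by simp only [L, h1, h2, eq_false ha, eq_false hb])
        all_goals refine Or.inr ?_
        all_goals simp only [L, if_neg ha, if_neg hb]
        · rw [h1]; omega
        · rw [h2]; omega
        · omega
  · let p : C(↥(L ⁻¹' {t}), ↥(puncturedConf q (l + 1))) := ContinuousMap.fst.restrict _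
    let p' : C(↥(L ⁻¹' {t}), ↥(puncturedConf q (l + 1))) := ContinuousMap.snd.restrict _
    have h1 := key p t.1 fun a => congrArg Prod.fst a.2
    have h2 := key p' t.2.1 fun a => congrArg (fun t => t.2.1) a.2
    have h3 : ∀ a : ↥(L ⁻¹' {t}), (e (p' a) ≠ -e (p a)) = t.2.2 := fun a =>
      congrArg (fun t => t.2.2) a.2
    refine h1.trans (ContinuousMap.Homotopic.trans ?_ h2.symm)
    refine (ContinuousMap.Homotopic.refl D).comp ?_
    by_cases ht : t.2.2
    · refine Punctured.homotopic_of_segment _ _ fun a s hs0 hs1 hz => ?_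
      have h4 : J ((1 - s) • e (p a) + s • e (p' a)) = 0 := by
        rw [← hz]
        simp only [v, ContinuousMap.comp_apply, ContinuousMap.coe_mk, map_add, map_smul]
        module
      have h5 : (1 - s) • e (p a) + s • e (p' a) = 0 := by
        rw [← norm_eq_zero, ← hJ, h4, norm_zero]
      have h6 : (1 - s) • e (p a) = -(s • e (p' a)) := eq_neg_of_add_eq_zero_left h5
      have h7 := congrArg norm h6
      rw [norm_neg, norm_smul, norm_smul, he, he, mul_one, mul_one, Real.norm_eq_abs,
        Real.norm_eq_abs, abs_of_nonneg (sub_nonneg.2 hs1), abs_of_nonneg hs0] at h7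
      refine ((h3 a).symm ▸ ht : e (p' a) ≠ -e (p a)) ?_
      rw [h7, ← smul_neg] at h6
      have h8 : s ≠ 0 := by rintro rfl; norm_num at h7
      rw [smul_right_injective E h8 h6, neg_neg]
    · have h4 : ∀ a, e (p' a) = -e (p a) := fun a => by
        by_contra h
        exact ht ((h3 a) ▸ h)
      let w : C(↥(L ⁻¹' {t}), Punctured E) := ⟨fun a => ⟨e (p a), fun h => by
        have := he (p a)
        rw [h, norm_zero] at this
        exact zero_ne_one this⟩, by fun_prop⟩
      have key2 : ∀ g : C(↥(L ⁻¹' {t}), Punctured E), (∀ a, inner ℝ (g a : E) (e (p a)) = 0) →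
          g.Homotopic w := by
        intro g hg
        refine Punctured.homotopic_of_segment _ _ fun a s hs0 hs1 hz => ?_
        have h5 := congrArg (fun u => inner ℝ u (e (p a))) hz
        simp only [w, ContinuousMap.coe_mk, inner_add_left, real_inner_smul_left, inner_sub_left,
          hg, inner_zero_left, real_inner_self_eq_norm_sq, he] at h5
        have h6 : s = 0 := by linarith
        rw [h6, zero_smul, add_zero] at hz
        exact (g a).2 hz
      refine (key2 _ fun a => hJ' _).trans (key2 _ fun a => ?_).symm
      have h5 : ((v.comp p') a : E) = J (e (p' a)) := rfl
      rw [h5, h4, map_neg, inner_neg_left, hJ', neg_zero]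

end PunctConfCovers

section Radial

variable {E : Type*} [NormedAddCommGroup E] [InnerProductSpace ℝ E]

/-- Rescaling by a factor depending on the distance from the origin is injective if it is
increasing along rays. -/
lemma injOn_radial {D : Set ℝ} {μ : ℝ → ℝ} (hpos : ∀ ρ ∈ D, 0 < μ ρ)
    (hmono : StrictMonoOn (fun ρ => ρ * μ ρ) D) {x y : E} (hx : ‖x‖ ∈ D) (hy : ‖y‖ ∈ D)
    (h : μ ‖x‖ • x = μ ‖y‖ • y) : x = y := by
  have h1 := congrArg norm h
  rw [norm_smul, norm_smul, Real.norm_eq_abs, Real.norm_eq_abs, abs_of_pos (hpos _ hx),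
    abs_of_pos (hpos _ hy), mul_comm, mul_comm (μ ‖y‖)] at h1
  rw [hmono.injOn hx hy h1] at h
  exact smul_right_injective E (hpos _ hy).ne' h

/-- A radial isotopy compressing `W'` into `W` transports motion planning covers of configuration
spaces. -/
theorem TCCover.of_radial {W W' : Set E} (hWW' : W ⊆ W') (p : E) {D : Set ℝ} {μ : ℝ → ℝ}
    (hD : ∀ x ∈ W', ‖x - p‖ ∈ D) (hμ : ContinuousOn μ D) (hpos : ∀ ρ ∈ D, 0 < μ ρ)
    (hmono : StrictMonoOn (fun ρ => ρ * μ ρ) D)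
    (hW : ∀ x ∈ W, ∀ t : ℝ, 0 ≤ t → t ≤ 1 → p + ((1 - t) + t * μ ‖x - p‖) • (x - p) ∈ W)
    (hW' : ∀ x ∈ W', p + μ ‖x - p‖ • (x - p) ∈ W) {k N : ℕ} (h : TCCover (Conf ↥W' k) N) :
    TCCover (Conf ↥W k) N := by
  have hμc : Continuous fun x : ↥W' => μ ‖(x : E) - p‖ :=
    hμ.comp_continuous (by fun_prop) fun x => hD x x.2
  let φ : C(↥W', ↥W) := ⟨fun x => ⟨p + μ ‖(x : E) - p‖ • (x - p), hW' x x.2⟩,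
    (continuous_const.add (hμc.smul (by fun_prop))).subtype_mk _⟩
  have hφ : Function.Injective φ := by
    intro x y hxy
    have h1 := add_left_cancel (congrArg Subtype.val hxy)
    exact Subtype.ext (sub_left_injective (injOn_radial hpos hmono (hD x x.2) (hD y y.2) h1))
  have hmonot : ∀ t : ℝ, 0 ≤ t → t ≤ 1 →
      StrictMonoOn (fun ρ => ρ * ((1 - t) + t * μ ρ)) D := by
    intro t ht0 ht1 a ha b hb hab
    have h1 := hmono ha hb hab
    simp only at h1 ⊢
    rcases ht0.eq_or_lt with rfl | ht0
    · linarith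
    · nlinarith [mul_pos ht0 (sub_pos.2 h1), mul_nonneg (sub_nonneg.2 ht1) (sub_pos.2 hab).le]
  have hpost : ∀ t : ℝ, 0 ≤ t → t ≤ 1 → ∀ ρ ∈ D, 0 < (1 - t) + t * μ ρ := by
    intro t ht0 ht1 ρ hρ
    rcases ht0.eq_or_lt with rfl | ht0
    · norm_num
    · linarith [mul_pos ht0 (hpos ρ hρ), sub_nonneg.2 ht1]
  let ψ : unitInterval × ↥W → ↥W := fun z =>
    ⟨p + ((1 - (z.1 : ℝ)) + z.1 * μ ‖(z.2 : E) - p‖) • (z.2 - p), hW z.2 z.2.2 z.1 z.1.2.1 z.1.2.2⟩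
  have hψ : Continuous ψ := by
    have h1 : Continuous fun z : unitInterval × ↥W => μ ‖(z.2 : E) - p‖ :=
      hμ.comp_continuous (by fun_prop) fun z => hD _ (hWW' z.2.2)
    have h2 : Continuous fun z : unitInterval × ↥W => (z.1 : ℝ) := by fun_prop
    exact (continuous_const.add (((continuous_const.sub h2).add (h2.mul h1)).smul
      (by fun_prop))).subtype_mk _
  have hψi : ∀ t, Function.Injective fun x => ψ (t, x) := by
    intro t x y hxy
    have h1 := add_left_cancel (congrArg Subtype.val hxy)
    exact Subtype.ext (sub_left_injective (injOn_radial (hpost t t.2.1 t.2.2)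
      (hmonot t t.2.1 t.2.2) (hD x (hWW' x.2)) (hD y (hWW' y.2)) h1))
  let f : C(Conf ↥W k, Conf ↥W' k) := ⟨fun x => ⟨fun i => ⟨x.1 i, hWW' (x.1 i).2⟩, fun i j hij =>
    x.2 (Subtype.ext (congrArg (fun w : ↥W' => (w : E)) hij))⟩, Continuous.subtype_mk (continuous_pi fun i =>
      (continuous_subtype_val.comp ((continuous_apply i).comp continuous_subtype_val)).subtype_mk _)
      _⟩
  let g : C(Conf ↥W' k, Conf ↥W k) := ⟨fun x => ⟨fun i => φ (x.1 i), hφ.comp x.2⟩,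
    Continuous.subtype_mk (continuous_pi fun i =>
      φ.continuous.comp ((continuous_apply i).comp continuous_subtype_val)) _⟩
  refine h.of_homotopic_id f g (ContinuousMap.Homotopic.symm ⟨⟨⟨fun z =>
    ⟨fun i => ψ (z.1, z.2.1 i), (hψi z.1).comp z.2.2⟩, ?_⟩, fun x => ?_, fun x => ?_⟩⟩)
  · exact Continuous.subtype_mk (continuous_pi fun i => hψ.comp (continuous_fst.prodMk
      ((continuous_apply i).comp (continuous_subtype_val.comp continuous_snd)))) _
  · ext i
    simp [ψ]
  · ext i
    simp [ψ, f, g, φ]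

end Radial

section Worlds

variable {E : Type*} [NormedAddCommGroup E]

/-- The world bounded by the sphere of radius `r0`, where only the obstacles with index in `S`
have been given their full size. -/
def partialWorld {m : ℕ} (r0 : ℝ) (c : Fin m → E) (r : Fin m → ℝ) (S : Finset (Fin m)) : Set E :=
  {x | ‖x‖ ≤ r0 ∧ (∀ i ∈ S, r i ≤ ‖x - c i‖) ∧ ∀ i, x ≠ c i}

lemma exists_enlarged_radius {m : ℕ} {r0 : ℝ} {c : Fin m → E} {r : Fin m → ℝ}
    (hin : ∀ i, ‖c i‖ + r i < r0) (hdisj : ∀ i j, i ≠ j → r i + r j < ‖c i - c j‖) (i : Fin m) :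
    ∃ R, r i < R ∧ ‖c i‖ + R < r0 ∧ ∀ j, i ≠ j → R + r j < ‖c i - c j‖ := by
  have h1 : ∀ᶠ R in 𝓝[>] r i, r i < R := self_mem_nhdsWithin
  have h2 : ∀ᶠ R in 𝓝 (r i), ‖c i‖ + R < r0 :=
    (isOpen_lt (by fun_prop) (by fun_prop)).mem_nhds (hin i)
  have h3 : ∀ᶠ R in 𝓝 (r i), ∀ j, i ≠ j → R + r j < ‖c i - c j‖ := by
    rw [Filter.eventually_all]
    intro j
    by_cases hij : i = j
    · exact Filter.Eventually.of_forall fun _ hne => absurd hij hne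
    · filter_upwards [(isOpen_lt (f := fun R => R + r j) (by fun_prop)
        continuous_const).mem_nhds (hdisj i j hij)] with R hR _ using hR
  exact (h1.and ((h2.filter_mono nhdsWithin_le_nhds).and
    (h3.filter_mono nhdsWithin_le_nhds))).exists

lemma puncturedConf.continuous_apply {E : Type*} [NormedAddCommGroup E] {m k : ℕ} (q : Fin m → E) (i : Fin k) :
    Continuous fun x : ↥(puncturedConf q k) => (x : Fin k → E) i :=
  (_root_.continuous_apply i).comp continuous_subtype_val

/-- Moving the obstacle to the origin. -/
lemma TCCover.puncturedConf_translate (a : E) {k N : ℕ}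
    (h : TCCover ↥(puncturedConf (fun _ : Fin 1 => (0 : E)) k) N) :
    TCCover ↥(puncturedConf (fun _ : Fin 1 => a) k) N := by
  let f : C(↥(puncturedConf (fun _ : Fin 1 => a) k),
      ↥(puncturedConf (fun _ : Fin 1 => (0 : E)) k)) :=
    ⟨fun x => ⟨fun i => x.1 i - a, fun i j hij => x.2.1 (sub_left_injective hij), fun i j =>
      sub_ne_zero.2 (x.2.2 i j)⟩, Continuous.subtype_mk (continuous_pi fun i =>
        (puncturedConf.continuous_apply _ i).sub continuous_const) _⟩
  let g : C(↥(puncturedConf (fun _ : Fin 1 => (0 : E)) k),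
      ↥(puncturedConf (fun _ : Fin 1 => a) k)) :=
    ⟨fun x => ⟨fun i => x.1 i + a, fun i j hij => x.2.1 (add_left_injective a hij), fun i j hij =>
      x.2.2 i j (add_eq_right.1 hij)⟩, Continuous.subtype_mk (continuous_pi fun i =>
        (puncturedConf.continuous_apply _ i).add continuous_const) _⟩
  refine h.of_homotopic_id f g ?_
  have : g.comp f = ContinuousMap.id _ := by
    ext x i
    simp [f, g]
  rw [this]

variable [InnerProductSpace ℝ E]

lemma TCCover.partialWorld_insert {m : ℕ} {r0 : ℝ} {c : Fin m → E} {r : Fin m → ℝ}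
    (hr : ∀ i, 0 < r i) (hin : ∀ i, ‖c i‖ + r i < r0)
    (hdisj : ∀ i j, i ≠ j → r i + r j < ‖c i - c j‖) (S : Finset (Fin m)) (i : Fin m) {k N : ℕ}
    (h : TCCover (Conf ↥(partialWorld r0 c r S) k) N) :
    TCCover (Conf ↥(partialWorld r0 c r (insert i S)) k) N := by
  obtain ⟨R, hR, hR0, hRj⟩ := exists_enlarged_radius hin hdisj i
  have hri := hr i
  have hRpos : 0 < R := hri.trans hR
  have hq : 0 < 1 - r i / R := sub_pos.2 ((div_lt_one hRpos).2 hR)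
  let μ : ℝ → ℝ := fun ρ => max 1 (r i / ρ + (1 - r i / R))
  have hμ1 : ∀ ρ, 1 ≤ μ ρ := fun ρ => le_max_left _ _
  have hμ : ∀ ρ, 0 < ρ → ρ * μ ρ = max ρ (r i + (1 - r i / R) * ρ) := by
    intro ρ hρ
    simp only [μ]
    rw [mul_max_of_nonneg _ _ hρ.le, mul_one]
    congr 1
    field_simp
  have hlt : ∀ ρ, 0 < ρ → ρ < R → ρ * μ ρ < R := by
    intro ρ hρ hρR
    rw [hμ ρ hρ]
    refine max_lt hρR ?_
    calc r i + (1 - r i / R) * ρ < r i + (1 - r i / R) * R := by gcongr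
      _ = R := by field_simp; ring
  have hge : ∀ ρ, R ≤ ρ → μ ρ = 1 := by
    intro ρ hρ
    refine max_eq_left ?_
    have : r i / ρ ≤ r i / R := by gcongr
    linarith
  have hmem : ∀ x ∈ partialWorld r0 c r S, ∀ t : ℝ, 0 ≤ t → t ≤ 1 →
      r i ≤ ‖x - c i‖ * ((1 - t) + t * μ ‖x - c i‖) →
      c i + ((1 - t) + t * μ ‖x - c i‖) • (x - c i) ∈ partialWorld r0 c r (insert i S) := by
    intro x hx t ht0 ht1 hrx
    have hρ : 0 < ‖x - c i‖ := norm_pos_iff.2 (sub_ne_zero.2 (hx.2.2 i))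
    rcases le_or_gt R ‖x - c i‖ with hRx | hRx
    · rw [hge _ hRx, mul_one, sub_add_cancel, one_smul, add_sub_cancel]
      refine ⟨hx.1, fun j hj => ?_, hx.2.2⟩
      rcases Finset.mem_insert.1 hj with rfl | hj
      exacts [hR.le.trans hRx, hx.2.1 j hj]
    · have hs : 0 < (1 - t) + t * μ ‖x - c i‖ := by
        nlinarith [mul_nonneg ht0 (sub_nonneg.2 (hμ1 ‖x - c i‖))]
      have hn : ‖((1 - t) + t * μ ‖x - c i‖) • (x - c i)‖ =
          ‖x - c i‖ * ((1 - t) + t * μ ‖x - c i‖) := by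
        rw [norm_smul, Real.norm_eq_abs, abs_of_pos hs, mul_comm]
      have hnR : ‖((1 - t) + t * μ ‖x - c i‖) • (x - c i)‖ ≤ R := by
        rw [hn]
        nlinarith [hlt _ hρ hRx]
      set w := ((1 - t) + t * μ ‖x - c i‖) • (x - c i) with hw
      have hj : ∀ j, i ≠ j → r j < ‖c i + w - c j‖ := by
        intro j hij
        have h1 := hRj j hij
        have h2 := norm_sub_le_norm_add (c i - c j) w
        rw [sub_add_eq_add_sub] at h2
        linarith
      refine ⟨?_, fun j hjS => ?_, fun j => ?_⟩
      · linarith [norm_add_le (c i) w]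
      · by_cases hij : i = j
        · subst hij
          rw [add_sub_cancel_left, hn]
          exact hrx
        · exact (hj j hij).le
      · by_cases hij : i = j
        · subst hij
          intro h0
          rw [add_eq_left] at h0
          rw [h0, norm_zero] at hn
          linarith
        · intro h0
          have h1 := hj j hij
          rw [h0, sub_self, norm_zero] at h1
          linarith [hr j]
  refine TCCover.of_radial (W' := partialWorld r0 c r S) (fun x hx => ⟨hx.1, fun j hj =>
    hx.2.1 j (Finset.mem_insert_of_mem hj), hx.2.2⟩) (c i) (D := Set.Ioi 0) (μ := μ)
    (fun x hx => norm_pos_iff.2 (sub_ne_zero.2 (hx.2.2 i))) ?_ (fun ρ _ => one_pos.trans_le (hμ1 ρ))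
    ?_ ?_ ?_ h
  · intro ρ hρ
    have hρ' : ρ ≠ 0 := ne_of_gt hρ
    exact ContinuousAt.continuousWithinAt (by fun_prop (disch := assumption))
  · intro a ha b hb hab
    simp only
    rw [hμ a ha, hμ b hb]
    exact max_lt_max hab (by gcongr)
  · intro x hx t ht0 ht1
    refine hmem x ⟨hx.1, fun j hj => hx.2.1 j (Finset.mem_insert_of_mem hj), hx.2.2⟩ t ht0 ht1 ?_
    have h1 := hx.2.1 i (Finset.mem_insert_self i S)
    have h2 : 1 ≤ (1 - t) + t * μ ‖x - c i‖ := by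
      nlinarith [mul_nonneg ht0 (sub_nonneg.2 (hμ1 ‖x - c i‖))]
    nlinarith
  · intro x hx
    have hρ : 0 < ‖x - c i‖ := norm_pos_iff.2 (sub_ne_zero.2 (hx.2.2 i))
    have h1 := hmem x hx 1 zero_le_one le_rfl ?_
    · simpa using h1
    · rw [sub_self, zero_add, one_mul, hμ _ hρ]
      refine le_max_of_le_right (le_add_of_nonneg_right ?_)
      positivity

lemma TCCover.partialWorld_empty {m : ℕ} {r0 : ℝ} (hr0 : 0 < r0) {c : Fin m → E} (r : Fin m → ℝ)
    (hin : ∀ i, ‖c i‖ < r0) {k N : ℕ} (h : TCCover (Conf ↥{x : E | ∀ i, x ≠ c i} k) N) :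
    TCCover (Conf ↥(partialWorld r0 c r ∅) k) N := by
  obtain ⟨R, hR, hR0, hRi⟩ : ∃ R, R < r0 ∧ 0 < R ∧ ∀ i, ‖c i‖ < R := by
    have h1 : ∀ᶠ R in 𝓝[<] r0, R < r0 := self_mem_nhdsWithin
    have h2 : ∀ᶠ R in 𝓝 r0, 0 < R := lt_mem_nhds hr0
    have h3 : ∀ᶠ R in 𝓝 r0, ∀ i, ‖c i‖ < R :=
      Filter.eventually_all.2 fun i => lt_mem_nhds (hin i)
    exact (h1.and ((h2.filter_mono nhdsWithin_le_nhds).and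
      (h3.filter_mono nhdsWithin_le_nhds))).exists
  obtain ⟨δ, hδ, rfl⟩ : ∃ δ, 0 < δ ∧ r0 = R + δ := ⟨r0 - R, sub_pos.2 hR, by ring⟩
  let μ : ℝ → ℝ := fun ρ => min 1 ((R + δ) / (δ + ρ))
  have hμ1 : ∀ ρ, μ ρ ≤ 1 := fun ρ => min_le_left _ _
  have hμ0 : ∀ ρ, 0 ≤ ρ → 0 < μ ρ := fun ρ hρ => lt_min one_pos (by positivity)
  have hμ : ∀ ρ, 0 ≤ ρ → ρ * μ ρ = min ρ ((R + δ) * (1 - δ / (δ + ρ))) := by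
    intro ρ hρ
    simp only [μ]
    rw [mul_min_of_nonneg _ _ hρ, mul_one]
    congr 1
    have : δ + ρ ≠ 0 := by positivity
    field_simp
    ring
  have hmono : StrictMonoOn (fun ρ => ρ * μ ρ) (Set.Ici 0) := by
    intro a ha b hb hab
    have ha' : 0 ≤ a := ha
    simp only
    rw [hμ a ha, hμ b hb]
    refine min_lt_min hab ?_
    have : δ / (δ + b) < δ / (δ + a) := by gcongr
    gcongr
  have hle : ∀ ρ, 0 ≤ ρ → ρ ≤ R → μ ρ = 1 := by
    intro ρ hρ hρR
    refine min_eq_left ?_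
    rw [le_div_iff₀ (by positivity)]
    linarith
  have hmem : ∀ x : E, (∀ i, x ≠ c i) → ∀ t : ℝ, 0 ≤ t → t ≤ 1 →
      ‖x‖ * ((1 - t) + t * μ ‖x‖) ≤ R + δ →
      (0 : E) + ((1 - t) + t * μ ‖x - 0‖) • (x - 0) ∈ partialWorld (R + δ) c r ∅ := by
    intro x hx t ht0 ht1 hle'
    rw [zero_add, sub_zero]
    have hs : 0 ≤ (1 - t) + t * μ ‖x‖ := by
      have := hμ0 ‖x‖ (norm_nonneg x)
      have := sub_nonneg.2 ht1
      positivity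
    have hn : ‖((1 - t) + t * μ ‖x‖) • x‖ = ‖x‖ * ((1 - t) + t * μ ‖x‖) := by
      rw [norm_smul, Real.norm_eq_abs, abs_of_nonneg hs, mul_comm]
    refine ⟨hn.trans_le hle', by simp, fun i => ?_⟩
    rcases le_or_gt ‖x‖ R with hxR | hxR
    · rw [hle _ (norm_nonneg x) hxR, mul_one, sub_add_cancel, one_smul]
      exact hx i
    · intro h0
      have h1 := hmono (Set.mem_Ici.2 hR0.le) (Set.mem_Ici.2 (norm_nonneg x)) hxR
      simp only [hle R hR0.le le_rfl, mul_one] at h1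
      rw [h0] at hn
      have h2 := hRi i
      nlinarith
  refine TCCover.of_radial (W' := {x : E | ∀ i, x ≠ c i}) (fun x hx => hx.2.2) 0 (D := Set.Ici 0)
    (μ := μ) (fun x _ => norm_nonneg _) ?_ (fun ρ hρ => hμ0 ρ hρ) hmono ?_ ?_ h
  · intro ρ hρ
    have hρ0 : 0 ≤ ρ := hρ
    have hρ' : δ + ρ ≠ 0 := by positivity
    exact ContinuousAt.continuousWithinAt (by fun_prop (disch := assumption))
  · intro x hx t ht0 ht1
    refine hmem x hx.2.2 t ht0 ht1 (le_trans ?_ hx.1)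
    refine mul_le_of_le_one_right (norm_nonneg x) ?_
    nlinarith [hμ1 ‖x‖]
  · intro x hx
    have h1 := hmem x hx 1 zero_le_one le_rfl ?_
    · simpa using h1
    · rw [sub_self, zero_add, one_mul, hμ _ (norm_nonneg x)]
      refine min_le_of_right_le ?_
      have h2 : 0 ≤ δ / (δ + ‖x‖) := by positivity
      nlinarith

/-- Motion planning covers for configurations in the complement of the centers give motion
planning covers for configurations in the sphere world. -/
theorem TCCover.sphereWorld {m : ℕ} {r0 : ℝ} (hr0 : 0 < r0) {c : Fin m → E} {r : Fin m → ℝ}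
    (hr : ∀ i, 0 < r i) (hin : ∀ i, ‖c i‖ + r i < r0)
    (hdisj : ∀ i j, i ≠ j → r i + r j < ‖c i - c j‖) {k N : ℕ}
    (h : TCCover ↥(puncturedConf c k) N) :
    TCCover (Conf ↥(Metric.closedBall (0 : E) r0 \ ⋃ i, Metric.ball (c i) (r i)) k) N := by
  have h1 : TCCover (Conf ↥{x : E | ∀ i, x ≠ c i} k) N := by
    let f : C(Conf ↥{x : E | ∀ i, x ≠ c i} k, ↥(puncturedConf c k)) :=
      ⟨fun x => ⟨fun i => x.1 i, fun i j hij => x.2 (Subtype.ext hij), fun i => (x.1 i).2⟩,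
        Continuous.subtype_mk (continuous_pi fun i => continuous_subtype_val.comp
          ((continuous_apply i).comp continuous_subtype_val)) _⟩
    let g : C(↥(puncturedConf c k), Conf ↥{x : E | ∀ i, x ≠ c i} k) :=
      ⟨fun x => ⟨fun i => ⟨x.1 i, x.2.2 i⟩, fun i j hij => x.2.1 (congrArg Subtype.val hij)⟩,
        Continuous.subtype_mk (continuous_pi fun i => Continuous.subtype_mk
          ((continuous_apply i).comp continuous_subtype_val) _) _⟩
    exact h.of_homotopic_id f g (ContinuousMap.Homotopic.refl _)
  have h2 : ∀ S : Finset (Fin m), TCCover (Conf ↥(partialWorld r0 c r S) k) N := by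
    intro S
    induction S using Finset.induction_on with
    | empty => exact TCCover.partialWorld_empty hr0 r (fun i => by linarith [hin i, hr i]) h1
    | insert i S _ ih => exact TCCover.partialWorld_insert hr hin hdisj S i ih
  have h3 : Metric.closedBall (0 : E) r0 \ ⋃ i, Metric.ball (c i) (r i) =
      partialWorld r0 c r Finset.univ := by
    ext x
    simp only [partialWorld, Set.mem_sdiff, mem_closedBall_zero_iff, Set.mem_iUnion, not_exists,
      mem_ball_iff_norm, not_lt, Set.mem_ofPred_eq, Finset.mem_univ, true_imp_iff]
    refine and_congr_right fun _ => ⟨fun hx => ⟨hx, fun i hi => ?_⟩, fun hx => hx.1⟩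
    have := hx i
    rw [hi, sub_self, norm_zero] at this
    exact absurd (hr i) (not_lt.2 this)
  rw [h3]
  exact h2 _

/-- Fixing the first point at the origin. -/
lemma TCCover.puncturedConf_succ (q : Fin 0 → E) {k N : ℕ}
    (h : TCCover ↥(puncturedConf (fun _ : Fin 1 => (0 : E)) k) N) :
    TCCover ↥(puncturedConf q (k + 1)) N := by
  let f : C(↥(puncturedConf q (k + 1)), ↥(puncturedConf (fun _ : Fin 1 => (0 : E)) k)) :=
    ⟨fun x => ⟨fun i => x.1 i.succ - x.1 0, fun i j hij =>
      Fin.succ_injective _ (x.2.1 (sub_left_injective hij)), fun i j =>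
      sub_ne_zero.2 (x.2.1.ne (Fin.succ_ne_zero i))⟩, Continuous.subtype_mk (continuous_pi fun i =>
        (puncturedConf.continuous_apply _ _).sub (puncturedConf.continuous_apply _ _)) _⟩
  let g : C(↥(puncturedConf (fun _ : Fin 1 => (0 : E)) k), ↥(puncturedConf q (k + 1))) :=
    ⟨fun x => ⟨Fin.cons 0 x.1, Fin.cons_injective_iff.2 ⟨fun ⟨i, hi⟩ => x.2.2 i 0 hi, x.2.1⟩,
      fun _ j => j.elim0⟩, by fun_prop⟩
  refine h.of_homotopic_id f g ⟨⟨⟨fun z => ⟨fun i => z.2.1 i - (1 - (z.1 : ℝ)) • z.2.1 0,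
    fun i j hij => z.2.2.1 (sub_left_injective hij), fun _ j => j.elim0⟩,
    Continuous.subtype_mk (continuous_pi fun i =>
      ((puncturedConf.continuous_apply _ _).comp continuous_snd).sub
      (Continuous.smul (by fun_prop) ((puncturedConf.continuous_apply _ _).comp continuous_snd)))
      _⟩, fun x => ?_, fun x => ?_⟩⟩
  · ext i
    refine Fin.cases ?_ (fun i => ?_) i <;> simp [f, g]
  · ext i
    simp

end Worlds

section SphereWorld

/-- Even-dimensional Euclidean spaces carry a norm-preserving linear field of orthogonal
vectors. -/
lemma exists_orthogonal_field {n : ℕ} (hn : Even n) :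
    ∃ J : EuclideanSpace ℝ (Fin n) →L[ℝ] EuclideanSpace ℝ (Fin n),
      (∀ x, ‖J x‖ = ‖x‖) ∧ ∀ x, inner ℝ (J x) x = 0 := by
  obtain ⟨s, rfl⟩ := hn
  let J : EuclideanSpace ℝ (Fin (s + s)) →ₗ[ℝ] EuclideanSpace ℝ (Fin (s + s)) :=
    { toFun := fun x => WithLp.toLp 2
        (Fin.append (fun i => -x (Fin.natAdd s i)) fun i => x (Fin.castAdd s i))
      map_add' := fun x y => by
        ext i
        refine Fin.addCases (fun i => ?_) (fun i => ?_) i <;>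
          simp [-Fin.natAdd_eq_addNat, add_comm]
      map_smul' := fun a x => by
        ext i
        refine Fin.addCases (fun i => ?_) (fun i => ?_) i <;>
          simp [-Fin.natAdd_eq_addNat] }
  refine ⟨LinearMap.toContinuousLinearMap J, fun x => ?_, fun x => ?_⟩
  · rw [EuclideanSpace.norm_eq, EuclideanSpace.norm_eq, Fin.sum_univ_add, Fin.sum_univ_add]
    simp [J, -Fin.natAdd_eq_addNat, add_comm]
  · rw [PiLp.inner_apply, Fin.sum_univ_add]
    simp [J, -Fin.natAdd_eq_addNat, mul_comm]

variable {E : Type*} [NormedAddCommGroup E]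

lemma mem_sphereWorld_of_annulus {m : ℕ} {r0 : ℝ} {c : Fin m → E} {r : Fin m → ℝ} {i : Fin m}
    {R : ℝ} (h0 : ‖c i‖ + R < r0) (hR : ∀ j, i ≠ j → R + r j < ‖c i - c j‖) {x : E}
    (hx : r i ≤ ‖x - c i‖) (hx' : ‖x - c i‖ ≤ R) :
    x ∈ Metric.closedBall (0 : E) r0 \ ⋃ i, Metric.ball (c i) (r i) := by
  simp only [Set.mem_sdiff, mem_closedBall_zero_iff, Set.mem_iUnion, not_exists,
    mem_ball_iff_norm, not_lt]
  refine ⟨?_, fun j => ?_⟩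
  · have := norm_add_le (c i) (x - c i)
    rw [add_sub_cancel] at this
    linarith
  · by_cases hij : i = j
    · exact hij ▸ hx
    · have h1 := hR j hij
      have h2 := norm_sub_le_norm_add (c i - c j) (x - c i)
      rw [sub_add_sub_cancel'] at h2
      linarith

end SphereWorld

/-- Topological complexity of the collision-free motion planning problem on an
even-dimensional sphere world. -/
theorem stmt11 (n m k : ℕ) (hn : 2 ≤ n) (hneven : Even n) (hk : 2 ≤ k)
    (r0 : ℝ) (hr0 : 0 < r0)
    (c : Fin m → EuclideanSpace ℝ (Fin n)) (r : Fin m → ℝ) (hr : ∀ i, 0 < r i)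
    (hin : ∀ i, ‖c i‖ + r i < r0)
    (hdisj : ∀ i j, i ≠ j → r i + r j < ‖c i - c j‖) :
    TopologicalComplexity
      (Conf (↥(Metric.closedBall (0 : EuclideanSpace ℝ (Fin n)) r0 \
        ⋃ i, Metric.ball (c i) (r i))) k)
      = if m = 0 then ((2 * k - 2 : ℕ) : ℕ∞)
        else if m = 1 then ((2 * k : ℕ) : ℕ∞)
        else ((2 * k + 1 : ℕ) : ℕ∞) := by
  obtain ⟨J, hJ, hJ'⟩ := exists_orthogonal_field hneven
  obtain ⟨u, hu⟩ : ∃ u : EuclideanSpace ℝ (Fin n), ‖u‖ = 1 :=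
    ⟨EuclideanSpace.single ⟨0, by omega⟩ 1, by simp⟩
  have hcenter : ∀ i, c i ∉ Metric.closedBall (0 : EuclideanSpace ℝ (Fin n)) r0 \
      ⋃ i, Metric.ball (c i) (r i) := fun i h =>
    h.2 (Set.mem_iUnion.2 ⟨i, Metric.mem_ball_self (hr i)⟩)
  split_ifs with h0 h1
  · subst h0
    obtain ⟨l, rfl⟩ : ∃ l, k = l + 1 + 1 := ⟨k - 2, by omega⟩
    refine topologicalComplexity_eq (TCCover.sphereWorld hr0 hr hin hdisj
      (TCCover.puncturedConf_succ c ?_)) fun N hN => ?_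
    · exact tcCover_puncturedConf_zero l J hJ hJ'
    · rw [show 2 * (l + 1 + 1) - 2 = 2 * l + 2 by omega]
      have hball : ∀ x : EuclideanSpace ℝ (Fin n), ‖x‖ ≤ r0 →
          x ∈ Metric.closedBall (0 : EuclideanSpace ℝ (Fin n)) r0 \
            ⋃ i, Metric.ball (c i) (r i) := fun x hx =>
        ⟨mem_closedBall_zero_iff.2 hx, by simp⟩
      refine two_mul_add_two_le_of_tcCover
        (fun j => ⟨fun x => (x.1 j.succ : EuclideanSpace ℝ (Fin n)), continuous_subtype_val.comp
          ((continuous_apply j.succ).comp continuous_subtype_val)⟩)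
        ⟨fun x => (x.1 0 : EuclideanSpace ℝ (Fin n)), continuous_subtype_val.comp
          ((continuous_apply 0).comp continuous_subtype_val)⟩
        (fun x i j hij => Fin.succ_injective _ (x.2 (Subtype.ext hij)))
        (fun x i hi => Fin.succ_ne_zero i (x.2 (Subtype.ext hi))) 0 u hu
        (half_pos hr0) (half_lt_self hr0) (fun F hF hF' => ?_) hN
      have hinj : ∀ θ, Function.Injective (Fin.cons 0 (F θ) : Fin (l + 2) → _) := fun θ =>
        Fin.cons_injective_iff.2 ⟨fun ⟨i, hi⟩ => by
          have := (hF' θ i).1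
          rw [hi, sub_zero, norm_zero] at this
          linarith, hF θ⟩
      have hmem : ∀ θ (j : Fin (l + 2)),
          ‖(Fin.cons 0 (F θ) : Fin (l + 2) → EuclideanSpace ℝ (Fin n)) j‖ ≤ r0 := fun θ j => by
        refine Fin.cases ?_ (fun j => ?_) j
        · simpa using hr0.le
        · simpa using (hF' θ j).2
      refine ⟨⟨fun θ => ⟨fun j => ⟨(Fin.cons 0 (F θ) : Fin (l + 2) → _) j, hball _ (hmem θ j)⟩,
        fun i j hij => hinj θ (congrArg Subtype.val hij)⟩, ?_⟩, fun θ => ⟨rfl, fun j => rfl⟩⟩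
      refine Continuous.subtype_mk (continuous_pi fun j => Continuous.subtype_mk ?_ _) _
      refine Fin.cases ?_ (fun j => ?_) j
      · exact continuous_const
      · exact (continuous_apply j).comp F.continuous
  · subst h1
    obtain ⟨l, rfl⟩ : ∃ l, k = l + 1 := ⟨k - 1, by omega⟩
    have hc : c = fun _ => c 0 := by
      funext i
      rw [Subsingleton.elim i 0]
    refine topologicalComplexity_eq (TCCover.sphereWorld hr0 hr hin hdisj ?_) fun N hN => ?_
    · rw [hc]
      exact TCCover.puncturedConf_translate _ (tcCover_puncturedConf_zero l J hJ hJ')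
    · obtain ⟨R, hR, hR0, hRj⟩ := exists_enlarged_radius hin hdisj 0
      refine two_mul_add_two_le_of_tcCover
        (fun j => ⟨fun x => (x.1 j : EuclideanSpace ℝ (Fin n)), continuous_subtype_val.comp
          ((continuous_apply j).comp continuous_subtype_val)⟩)
        (ContinuousMap.const _ (c 0))
        (fun x i j hij => x.2 (Subtype.ext hij))
        (fun x i hi => by
          have hi' : (x.1 i : EuclideanSpace ℝ (Fin n)) = c 0 := hi
          exact hcenter 0 (hi' ▸ (x.1 i).2)) (c 0) u hu
        (hr 0) hR (fun F hF hF' => ?_) hN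
      exact ⟨⟨fun θ => ⟨fun j => ⟨F θ j, mem_sphereWorld_of_annulus hR0 hRj (hF' θ j).1
        (hF' θ j).2⟩, fun i j hij => hF θ (congrArg Subtype.val hij)⟩,
        Continuous.subtype_mk (continuous_pi fun j => Continuous.subtype_mk
          ((continuous_apply j).comp F.continuous) _) _⟩, fun θ => ⟨rfl, fun j => rfl⟩⟩
  · refine topologicalComplexity_eq (TCCover.sphereWorld hr0 hr hin hdisj
      (tcCover_puncturedConf c u (J u) hu ((hJ u).trans hu) (hJ' u))) fun N hN => ?_
    let a : Bool → Fin m := fun i => if i then ⟨0, by omega⟩ else ⟨1, by omega⟩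
    have ha : ∀ i, a i ≠ a !i := by
      intro i
      cases i <;> simp [a]
    choose R hR hR0 hRj using exists_enlarged_radius hin hdisj
    refine two_mul_lt_of_tcCover (by omega) (fun i => c (a i)) (fun i => hr (a i))
      (fun i => hR (a i)) (fun i x hx hx' => mem_sphereWorld_of_annulus (hR0 _) (hRj _) hx hx')
      (fun i => hcenter _) (fun i => ?_) hN
    have := hRj _ _ (ha i)
    linarith [hr (a !i)]
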